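/- arXiv:2211.09571 — 6 statements merged into one kernel-verified Lean document; each statement's English description precedes it below -/
import Mathlib

section
/- There exists an anonymous hedonic game with exactly 15 agents in which every agent's preferences over coalition sizes are strict and generally single-peaked, and which admits no individually stable partition. -/
/-- A partition of the agent set `A`, encoded by the map sending each agent to
the coalition containing it. -/
def IsPartition {A : Type*} [DecidableEq A] (π : A → Finset A) : Prop :=
  (∀ i, i ∈ π i) ∧ ∀ i j, i ∈ π j → π i = π j

/-- Strict part of a weak preference relation `r`. -/
def StrictPref {α : Type*} (r : α → α → Prop) (x y : α) : Prop :=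
  r x y ∧ ¬ r y x

/-- `π'` is obtained from `π` by an IS deviation of agent `i`, where
`wp j C D` means that agent `j` weakly prefers coalition `C` to coalition `D`. -/
def IsISDeviation {A : Type*} [DecidableEq A]
    (wp : A → Finset A → Finset A → Prop) (π π' : A → Finset A) (i : A) : Prop :=
  π' i ≠ π i ∧
  (∀ j, j ≠ i → (π' j).erase i = (π j).erase i) ∧
  StrictPref (wp i) (π' i) (π i) ∧
  ∀ j ∈ (π' i).erase i, wp j (π' j) (π j)

/-- One step of the dynamics of IS deviations between partitions. -/
def ISStep {A : Type*} [DecidableEq A]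
    (wp : A → Finset A → Finset A → Prop) (π π' : A → Finset A) : Prop :=
  IsPartition π ∧ IsPartition π' ∧ ∃ i, IsISDeviation wp π π' i

/-- A partition is individually stable if no IS deviation from it is possible. -/
def IndividuallyStable {A : Type*} [DecidableEq A]
    (wp : A → Finset A → Finset A → Prop) (π : A → Finset A) : Prop :=
  IsPartition π ∧ ∀ π' : A → Finset A, ¬ ISStep wp π π'

/-- `r` is a weak order (total preorder) on the set `S`. -/
def WeakOrderOn {α : Type*} (r : α → α → Prop) (S : Set α) : Prop :=
  (∀ x ∈ S, ∀ y ∈ S, r x y ∨ r y x) ∧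
  ∀ x ∈ S, ∀ y ∈ S, ∀ z ∈ S, r x y → r y z → r x z

/-- `r` is antisymmetric on `S`, i.e. the preferences are strict. -/
def StrictPrefsOn {α : Type*} (r : α → α → Prop) (S : Set α) : Prop :=
  ∀ x ∈ S, ∀ y ∈ S, r x y → r y x → x = y

/-- `r` is (naturally) single-peaked on `S` with respect to the natural linear
order of `α`: whenever `y` lies strictly between `x` and `z`, `x ≻ y` implies `y ≿ z`. -/
def SinglePeakedOn {α : Type*} [LinearOrder α] (r : α → α → Prop) (S : Set α) : Prop :=
  ∀ x ∈ S, ∀ y ∈ S, ∀ z ∈ S,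
    ((x < y ∧ y < z) ∨ (z < y ∧ y < x)) → StrictPref r x y → r y z

/-- Coalition preferences of an anonymous hedonic game: coalitions are compared
by their sizes via the size preferences `sp`. -/
def ahgPref {A : Type*} [DecidableEq A] (sp : A → ℕ → ℕ → Prop) :
    A → Finset A → Finset A → Prop :=
  fun i C D => sp i C.card D.card

/-- The size preferences of all agents are single-peaked with respect to a common
linear order on `{1,…,n}`, encoded by a ranking `f` that is injective on `{1,…,n}`
(`f x > f y` meaning that `x` is greater than `y` on the axis). -/
def GenSinglePeakedProfile {A : Type*} (sp : A → ℕ → ℕ → Prop) (n : ℕ) : Prop :=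
  ∃ f : ℕ → ℕ,
    (∀ x ∈ Set.Icc 1 n, ∀ y ∈ Set.Icc 1 n, f x = f y → x = y) ∧
    ∀ i : A, ∀ x ∈ Set.Icc 1 n, ∀ y ∈ Set.Icc 1 n, ∀ z ∈ Set.Icc 1 n,
      ((f y < f x ∧ f z < f y) ∨ (f y < f z ∧ f x < f y)) →
      StrictPref (sp i) x y → sp i y z

/-- Preference lists (best size first) of the four types of agents. -/
def prefList : ℕ → List ℕ
  | 0 => [2, 3, 13, 12, 1, 15, 14, 11, 10, 9, 8, 7, 6, 5, 4]
  | 1 => [13, 3, 2, 1, 12, 15, 14, 11, 10, 9, 8, 7, 6, 5, 4]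
  | 2 => [3, 2, 1, 13, 12, 15, 14, 11, 10, 9, 8, 7, 6, 5, 4]
  | _ => [13, 12, 15, 14, 11, 10, 9, 8, 7, 6, 5, 4, 3, 2, 1]

/-- The type of an agent: agents 2 and 3 are alike, and so are agents 4, …, 14. -/
def agentType (i : Fin 15) : ℕ :=
  if i = 0 then 0 else if i = 1 then 1 else if i ≤ 3 then 2 else 3

/-- Rank of a size for an agent (smaller is better). -/
def rk (i : Fin 15) (x : ℕ) : ℕ := (prefList (agentType i)).idxOf x

/-- Position of a size on the common axis. -/
def axis (x : ℕ) : ℕ := [1, 2, 3, 13, 12, 15, 14, 11, 10, 9, 8, 7, 6, 5, 4].idxOf x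

theorem agentType_lt (i : Fin 15) : agentType i < 4 := by
  unfold agentType; split_ifs <;> omega

theorem agentType_big (i : Fin 15) (h : 4 ≤ i) : agentType i = 3 := by
  revert h; revert i; decide

theorem rk_inj : ∀ t : Fin 4, ∀ x y : Fin 16, 1 ≤ x.val → 1 ≤ y.val →
    (prefList t.val).idxOf x.val = (prefList t.val).idxOf y.val → x.val = y.val := by
  decide +kernel

theorem axis_inj : ∀ x < 16, 1 ≤ x → ∀ y < 16, 1 ≤ y → axis x = axis y → x = y := by
  decide +kernel

theorem rk_sp : ∀ t : Fin 4, ∀ x y z : Fin 16, 1 ≤ x.val → 1 ≤ y.val → 1 ≤ z.val →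
    ((axis y.val < axis x.val ∧ axis z.val < axis y.val) ∨
      (axis y.val < axis z.val ∧ axis x.val < axis y.val)) →
    (prefList t.val).idxOf x.val < (prefList t.val).idxOf y.val →
    (prefList t.val).idxOf y.val ≤ (prefList t.val).idxOf z.val := by
  decide +kernel

/-- In a stable partition no agent can join another coalition. -/
theorem move {π : Fin 15 → Finset (Fin 15)}
    (h : IndividuallyStable (ahgPref fun i x y => rk i x ≤ rk i y) π) (i : Fin 15)
    (C : Finset (Fin 15)) (hC : C = ∅ ∨ ∃ j, C = π j) (hi : i ∉ C)
    (hlt : rk i (C.card + 1) < rk i (π i).card)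
    (hall : ∀ k ∈ C, rk k (C.card + 1) ≤ rk k C.card) : False := by
  obtain ⟨⟨hm, he⟩, hs⟩ := h
  have hCm : ∀ k ∈ C, π k = C := by
    intro k hk
    rcases hC with rfl | ⟨j, rfl⟩
    · simp at hk
    · exact he k j hk
  have hCm' : ∀ k, ∀ l ∈ π k, l ∈ C → k ∈ C := by
    intro k l hl hlC
    have h1 := he l k hl
    rw [hCm l hlC] at h1
    rw [h1]; exact hm k
  have hcard : (insert i C).card = C.card + 1 := Finset.card_insert_of_notMem hi
  let π' : Fin 15 → Finset (Fin 15) := fun k => if k ∈ insert i C then insert i C else (π k).erase i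
  have hin : ∀ k ∈ insert i C, π' k = insert i C := fun k hk => if_pos hk
  have hout : ∀ k, k ∉ insert i C → π' k = (π k).erase i := fun k hk => if_neg hk
  have hii : π' i = insert i C := hin i (Finset.mem_insert_self _ _)
  apply hs π'
  refine ⟨⟨hm, he⟩, ⟨?_, ?_⟩, i, ?_, ?_, ?_, ?_⟩
  · intro k
    by_cases hk : k ∈ insert i C
    · rw [hin k hk]; exact hk
    · rw [hout k hk]
      refine Finset.mem_erase.2 ⟨?_, hm k⟩
      rintro rfl; simp at hk
  · intro k l hkl
    by_cases hl : l ∈ insert i C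
    · rw [hin l hl] at hkl ⊢
      exact hin k hkl
    · rw [hout l hl] at hkl ⊢
      obtain ⟨hki, hkl⟩ := Finset.mem_erase.1 hkl
      have hk : k ∉ insert i C := by
        intro hk
        have hkC := (Finset.mem_insert.1 hk).resolve_left hki
        exact hl (Finset.mem_insert_of_mem (hCm' l k hkl hkC))
      rw [hout k hk, he k l hkl]
  · rw [hii]
    intro heq
    rw [← heq, hcard] at hlt
    exact lt_irrefl _ hlt
  · intro k hk
    by_cases hk' : k ∈ insert i C
    · have hkC := (Finset.mem_insert.1 hk').resolve_left hk
      rw [hin k hk', hCm k hkC, Finset.erase_insert_eq_erase]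
    · rw [hout k hk', Finset.erase_idem]
  · rw [hii]
    simp only [StrictPref, ahgPref, hcard]
    omega
  · intro k hk
    rw [hii] at hk
    obtain ⟨hki, hk'⟩ := Finset.mem_erase.1 hk
    have hkC := (Finset.mem_insert.1 hk').resolve_left hki
    rw [hin k hk', hCm k hkC]
    simp only [ahgPref, hcard]
    exact hall k hkC

/-- The agents of the last type. -/
def big : Finset (Fin 15) := {4, 5, 6, 7, 8, 9, 10, 11, 12, 13, 14}

theorem mem_big (i : Fin 15) : i ∈ big ↔ 4 ≤ i := by revert i; decide

theorem small_cases (i : Fin 15) (h : i ∉ big) : i = 0 ∨ i = 1 ∨ i = 2 ∨ i = 3 := by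
  revert h; revert i; decide

theorem ir_small : ∀ s < 16, 1 ≤ s →
    (rk 0 s ≤ rk 0 1 → s ≤ 3 ∨ s = 12 ∨ s = 13) ∧ (rk 1 s ≤ rk 1 1 → s ≤ 3 ∨ s = 13) ∧
    (rk 2 s ≤ rk 2 1 → s ≤ 3) ∧ (rk 3 s ≤ rk 3 1 → s ≤ 3) := by
  decide +kernel

theorem big_up : ∀ k ≤ 10, ∀ s < 16, 1 ≤ s → s ≤ k → rk 4 (k + 1) < rk 4 s := by
  decide +kernel

theorem rk_big (i : Fin 15) (h : i ∈ big) (x : ℕ) : rk i x = rk 4 x := by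
  unfold rk
  rw [agentType_big i ((mem_big i).1 h)]; rfl

/-- The coalition of the agents of the last type. -/
theorem big_coalition {π : Fin 15 → Finset (Fin 15)}
    (h : IndividuallyStable (ahgPref fun i x y => rk i x ≤ rk i y) π) :
    π 4 = big ∨ π 4 = insert 0 big ∨ π 4 = insert 0 (insert 1 big) := by
  have hmove := move h
  obtain ⟨⟨hm, he⟩, -⟩ := h
  have hpos : ∀ i, 1 ≤ (π i).card := fun i => Finset.card_pos.2 ⟨i, hm i⟩
  have hlt : ∀ i, (π i).card < 16 := fun i => Nat.lt_succ_of_le (by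
    simpa using Finset.card_le_univ (π i))
  have hir : ∀ i, rk i (π i).card ≤ rk i 1 := by
    intro i
    by_contra hc
    exact hmove i ∅ (Or.inl rfl) (by simp) (by simpa using hc) (by simp)
  have ir0 := (ir_small _ (hlt 0) (hpos 0)).1 (hir 0)
  have ir1 := (ir_small _ (hlt 1) (hpos 1)).2.1 (hir 1)
  have ir2 := (ir_small _ (hlt 2) (hpos 2)).2.2.1 (hir 2)
  have ir3 := (ir_small _ (hlt 3) (hpos 3)).2.2.2 (hir 3)
  -- a coalition of size 13
  have c13 : ∀ i, (π i).card = 13 → π 4 = insert 0 (insert 1 big) := by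
    intro i hi
    have hsub : π i ⊆ insert 0 (insert 1 big) := by
      intro k hk
      have hk' : (π k).card = 13 := by rw [he k i hk, hi]
      by_cases hb : k ∈ big
      · simp [hb]
      · rcases small_cases k hb with rfl | rfl | rfl | rfl
        · simp
        · simp
        · omega
        · omega
    have heq : π i = insert 0 (insert 1 big) :=
      Finset.eq_of_subset_of_card_le hsub (by rw [hi]; decide)
    rw [he 4 i (by rw [heq]; decide), heq]
  have c12 : ∀ i, (π i).card = 12 → π 4 = insert 0 big := by
    intro i hi
    have hsub : π i ⊆ insert 0 big := by
      intro k hk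
      have hk' : (π k).card = 12 := by rw [he k i hk, hi]
      by_cases hb : k ∈ big
      · simp [hb]
      · rcases small_cases k hb with rfl | rfl | rfl | rfl
        · simp
        · omega
        · omega
        · omega
    have heq : π i = insert 0 big :=
      Finset.eq_of_subset_of_card_le hsub (by rw [hi]; decide)
    rw [he 4 i (by rw [heq]; decide), heq]
  by_cases h13 : (π 0).card = 13
  · exact Or.inr (Or.inr (c13 0 h13))
  by_cases h13' : (π 1).card = 13
  · exact Or.inr (Or.inr (c13 1 h13'))
  by_cases h12 : (π 0).card = 12
  · exact Or.inr (Or.inl (c12 0 h12))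
  left
  -- now all small agents are in coalitions of size at most 3
  have s0 : (π 0).card ≤ 3 := by omega
  have s1 : (π 1).card ≤ 3 := by omega
  let U := ((π 0).erase 0 ∪ (π 1).erase 1) ∪ ((π 2).erase 2 ∪ (π 3).erase 3)
  have hU : U.card ≤ 8 := by
    have e0 := Finset.card_erase_of_mem (hm 0)
    have e1 := Finset.card_erase_of_mem (hm 1)
    have e2 := Finset.card_erase_of_mem (hm 2)
    have e3 := Finset.card_erase_of_mem (hm 3)
    have u1 := Finset.card_union_le ((π 0).erase 0 ∪ (π 1).erase 1) ((π 2).erase 2 ∪ (π 3).erase 3)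
    have u2 := Finset.card_union_le ((π 0).erase 0) ((π 1).erase 1)
    have u3 := Finset.card_union_le ((π 2).erase 2) ((π 3).erase 3)
    change (((π 0).erase 0 ∪ (π 1).erase 1) ∪ ((π 2).erase 2 ∪ (π 3).erase 3)).card ≤ 8
    omega
  have hmix : ∀ i ∈ big, ¬ π i ⊆ big → i ∈ U ∧ (π i).card ≤ 3 := by
    intro i hi hn
    obtain ⟨k, hk, hkb⟩ := Finset.not_subset.1 hn
    have hki := he k i hk
    have hik : i ∈ π k := by rw [hki]; exact hm i
    have hne : i ≠ k := by rintro rfl; exact hkb hi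
    have hik' : i ∈ (π k).erase k := Finset.mem_erase.2 ⟨hne, hik⟩
    rw [← hki]
    rcases small_cases k hkb with rfl | rfl | rfl | rfl
    · exact ⟨by simp only [U, Finset.mem_union]; tauto, s0⟩
    · exact ⟨by simp only [U, Finset.mem_union]; tauto, s1⟩
    · exact ⟨by simp only [U, Finset.mem_union]; tauto, ir2⟩
    · exact ⟨by simp only [U, Finset.mem_union]; tauto, ir3⟩
  have hbig : big.card = 11 := by decide
  obtain ⟨j0, hj0, hj0'⟩ : ∃ j ∈ big, π j ⊆ big := by
    by_contra! hc
    have := Finset.card_le_card (fun i hi => (hmix i hi (hc i hi)).1 : big ⊆ U)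
    omega
  obtain ⟨j, hj, hmax⟩ := Finset.exists_max_image (big.filter fun j => π j ⊆ big)
    (fun j => (π j).card) ⟨j0, by simp [hj0, hj0']⟩
  obtain ⟨hjb, hjs⟩ := Finset.mem_filter.1 hj
  by_cases hk : (π j).card ≤ 10
  · exfalso
    have hother : ∀ i ∈ big, i ∉ π j → i ∈ U ∧ (π j).card ≤ 2 := by
      intro i hi hij
      have hgt : (π j).card < (π i).card := by
        by_contra! hle
        refine hmove i (π j) (Or.inr ⟨j, rfl⟩) hij ?_ ?_
        · rw [rk_big i hi, rk_big i hi]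
          exact big_up _ hk _ (hlt i) (hpos i) hle
        · intro k hkj
          rw [rk_big k (hjs hkj), rk_big k (hjs hkj)]
          exact (big_up _ hk _ (hlt j) (hpos j) le_rfl).le
      have hns : ¬ π i ⊆ big := by
        intro hs
        have := hmax i (by simp [hi, hs])
        omega
      have := hmix i hi hns
      exact ⟨this.1, by omega⟩
    obtain ⟨i, hi, hij⟩ : ∃ i ∈ big, i ∉ π j := by
      by_contra! hc
      have := Finset.card_le_card (hc : big ⊆ π j)
      omega
    have h2 := (hother i hi hij).2
    have hsub : big ⊆ U ∪ π j := by
      intro l hl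
      by_cases hlj : l ∈ π j
      · exact Finset.mem_union_right _ hlj
      · exact Finset.mem_union_left _ (hother l hl hlj).1
    have := Finset.card_le_card hsub
    have := Finset.card_union_le U (π j)
    omega
  · have heq : π j = big := Finset.eq_of_subset_of_card_le hjs (by omega)
    rw [he 4 j (by rw [heq]; decide), heq]

/-- The coalition of small agents with the given members. -/
def co (a b c d : Bool) : Finset (Fin 15) :=
  (if a then {0} else ∅) ∪ (if b then {1} else ∅) ∪ (if c then {2} else ∅) ∪
    (if d then {3} else ∅)

theorem mem_co : ∀ a b c d : Bool, ((0 ∈ co a b c d) ↔ a = true) ∧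
    ((1 ∈ co a b c d) ↔ b = true) ∧ ((2 ∈ co a b c d) ↔ c = true) ∧
    ((3 ∈ co a b c d) ↔ d = true) ∧ ∀ i ∈ big, i ∉ co a b c d := by
  decide

/-- A coalition disjoint from `big` is determined by its small members. -/
theorem expl (C : Finset (Fin 15)) (hC : ∀ i ∈ C, i ∉ big) (a b c d : Bool)
    (ha : (0 ∈ C) ↔ a = true) (hb : (1 ∈ C) ↔ b = true) (hc : (2 ∈ C) ↔ c = true)
    (hd : (3 ∈ C) ↔ d = true) : C = co a b c d := by
  obtain ⟨h0, h1, h2, h3, h4⟩ := mem_co a b c d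
  ext i
  by_cases hi : i ∈ big
  · exact iff_of_false (fun h => hC i h hi) (h4 i hi)
  · rcases small_cases i hi with rfl | rfl | rfl | rfl
    · rw [ha, h0]
    · rw [hb, h1]
    · rw [hc, h2]
    · rw [hd, h3]

/-- Inclusion of the first five agents. -/
abbrev emb (j : Fin 5) : Fin 15 := j.castLE (by omega)

/-- `p` gives the coalitions of agents 0, …, 4; it is consistent with a partition. -/
abbrev Consistent (p : Fin 5 → Finset (Fin 15)) : Prop :=
  ∀ i j : Fin 5, emb i ∈ p j → p i = p j

/-- Some agent has a deviation. -/
abbrev Movable (p : Fin 5 → Finset (Fin 15)) : Prop :=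
  ∃ i : Fin 5, rk (emb i) 1 < rk (emb i) (p i).card ∨
    ∃ j : Fin 5, emb i ∉ p j ∧ rk (emb i) ((p j).card + 1) < rk (emb i) (p i).card ∧
      ∀ k ∈ p j, rk k ((p j).card + 1) ≤ rk k (p j).card

theorem movable1 : ∀ x01 x02 x03 x12 x13 x23 : Bool,
    Consistent ![co true x01 x02 x03, co x01 true x12 x13, co x02 x12 true x23,
      co x03 x13 x23 true, big] →
    Movable ![co true x01 x02 x03, co x01 true x12 x13, co x02 x12 true x23,
      co x03 x13 x23 true, big] := by
  decide +kernel

theorem movable2 : ∀ x12 x13 x23 : Bool,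
    Consistent ![insert 0 big, co false true x12 x13, co false x12 true x23,
      co false x13 x23 true, insert 0 big] →
    Movable ![insert 0 big, co false true x12 x13, co false x12 true x23,
      co false x13 x23 true, insert 0 big] := by
  decide +kernel

theorem movable3 : ∀ x23 : Bool,
    Movable ![insert 0 (insert 1 big), insert 0 (insert 1 big), co false false true x23,
      co false false x23 true, insert 0 (insert 1 big)] := by
  decide +kernel

theorem not_stable {π : Fin 15 → Finset (Fin 15)}
    (h : IndividuallyStable (ahgPref fun i x y => rk i x ≤ rk i y) π) : False := by
  have hmove := move h
  have hbig := big_coalition h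
  obtain ⟨⟨hm, he⟩, -⟩ := h
  have hcons : Consistent fun j => π (emb j) := fun i j hij => he _ _ hij
  have hmov : ¬ Movable fun j => π (emb j) := by
    rintro ⟨i, hi | ⟨j, h1, h2, h3⟩⟩
    · exact hmove (emb i) ∅ (Or.inl rfl) (by simp) (by simpa using hi) (by simp)
    · exact hmove (emb i) (π (emb j)) (Or.inr ⟨_, rfl⟩) h1 h2 h3
  have hp : ∀ a b c d e, π 0 = a → π 1 = b → π 2 = c → π 3 = d → π 4 = e →
      (fun j => π (emb j)) = ![a, b, c, d, e] := by
    rintro a b c d e rfl rfl rfl rfl rfl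
    ext1 j
    fin_cases j <;> rfl
  have hsymm : ∀ i j, i ∈ π j ↔ j ∈ π i := by
    intro i j
    constructor
    · intro hij; rw [he i j hij]; exact hm j
    · intro hij; rw [he j i hij]; exact hm i
  -- agents outside the coalition of agent 4 form coalitions without big agents
  have hsub : big ⊆ π 4 := by
    rcases hbig with h | h | h <;> rw [h] <;> decide
  have hdis : ∀ k, k ∉ π 4 → ∀ i ∈ π k, i ∉ big := by
    intro k hk i hi hib
    apply hk
    rw [← he i 4 (hsub hib), he i k hi]
    exact hm k
  have hsep : ∀ k l, l ∈ π 4 → k ∉ π 4 → (l ∈ π k ↔ false = true) := by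
    intro k l hl hk
    refine iff_of_false (fun hlk => hk ?_) (by simp)
    rw [← he l 4 hl, he l k hlk]
    exact hm k
  have hself : ∀ k, k ∈ π k ↔ true = true := fun k => iff_of_true (hm k) rfl
  have hdec : ∀ k l, k ∈ π l ↔ decide (l ∈ π k) = true := by
    intro k l; rw [decide_eq_true_iff]; exact hsymm k l
  have hdec' : ∀ k l, k ∈ π l ↔ decide (k ∈ π l) = true := by
    intro k l; rw [decide_eq_true_iff]
  rcases hbig with h4 | h4 | h4
  · have o : ∀ k : Fin 15, k ∉ big → k ∉ π 4 := fun k hk => by rwa [h4]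
    have e := hp _ _ _ _ _
      (expl (π 0) (hdis 0 (o 0 (by decide))) _ _ _ _ (hself 0) (hdec 1 0) (hdec 2 0) (hdec 3 0))
      (expl (π 1) (hdis 1 (o 1 (by decide))) _ _ _ _ (hdec' 0 1) (hself 1) (hdec 2 1) (hdec 3 1))
      (expl (π 2) (hdis 2 (o 2 (by decide))) _ _ _ _ (hdec' 0 2) (hdec' 1 2) (hself 2) (hdec 3 2))
      (expl (π 3) (hdis 3 (o 3 (by decide))) _ _ _ _ (hdec' 0 3) (hdec' 1 3) (hdec' 2 3) (hself 3))
      h4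
    rw [e] at hcons hmov
    exact hmov (movable1 _ _ _ _ _ _ hcons)
  · have o : ∀ k : Fin 15, k ∉ insert 0 big → k ∉ π 4 := fun k hk => by rwa [h4]
    have i0 : 0 ∈ π 4 := by rw [h4]; decide
    have o1 := o 1 (by decide)
    have o2 := o 2 (by decide)
    have o3 := o 3 (by decide)
    have e := hp _ _ _ _ _ ((he 0 4 i0).trans h4)
      (expl (π 1) (hdis 1 o1) _ _ _ _ (hsep 1 0 i0 o1) (hself 1) (hdec 2 1) (hdec 3 1))
      (expl (π 2) (hdis 2 o2) _ _ _ _ (hsep 2 0 i0 o2) (hdec' 1 2) (hself 2) (hdec 3 2))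
      (expl (π 3) (hdis 3 o3) _ _ _ _ (hsep 3 0 i0 o3) (hdec' 1 3) (hdec' 2 3) (hself 3))
      h4
    rw [e] at hcons hmov
    exact hmov (movable2 _ _ _ hcons)
  · have o : ∀ k : Fin 15, k ∉ insert 0 (insert 1 big) → k ∉ π 4 := fun k hk => by rwa [h4]
    have i0 : 0 ∈ π 4 := by rw [h4]; decide
    have i1 : 1 ∈ π 4 := by rw [h4]; decide
    have o2 := o 2 (by decide)
    have o3 := o 3 (by decide)
    have e := hp _ _ _ _ _ ((he 0 4 i0).trans h4) ((he 1 4 i1).trans h4)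
      (expl (π 2) (hdis 2 o2) _ _ _ _ (hsep 2 0 i0 o2) (hsep 2 1 i1 o2) (hself 2) (hdec 3 2))
      (expl (π 3) (hdis 3 o3) _ _ _ _ (hsep 3 0 i0 o3) (hsep 3 1 i1 o3) (hdec' 2 3) (hself 3))
      h4
    rw [e] at hmov
    exact hmov (movable3 _)

/-- There exists an anonymous hedonic game with exactly 15 agents in which all
agents have strict and generally single-peaked preferences over coalition sizes
and which admits no individually stable partition. -/
theorem ahg_15_strict_genSP_no_IS_partition :
    ∃ sp : Fin 15 → ℕ → ℕ → Prop,
      (∀ i, WeakOrderOn (sp i) (Set.Icc 1 15)) ∧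
      (∀ i, StrictPrefsOn (sp i) (Set.Icc 1 15)) ∧
      GenSinglePeakedProfile sp 15 ∧
      ¬ ∃ π : Fin 15 → Finset (Fin 15), IndividuallyStable (ahgPref sp) π := by
  refine ⟨fun i x y => rk i x ≤ rk i y, fun i => ⟨fun x _ y _ => le_total _ _,
    fun x _ y _ z _ => le_trans⟩, ?_, ⟨axis, ?_, ?_⟩, ?_⟩
  · intro i x hx y hy hxy hyx
    exact rk_inj ⟨_, agentType_lt i⟩ ⟨x, Nat.lt_succ_of_le hx.2⟩ ⟨y, Nat.lt_succ_of_le hy.2⟩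
      hx.1 hy.1 (le_antisymm hxy hyx)
  · intro x hx y hy
    exact axis_inj x (Nat.lt_succ_of_le hx.2) hx.1 y (Nat.lt_succ_of_le hy.2) hy.1
  · intro i x hx y hy z hz hxyz hp
    exact rk_sp ⟨_, agentType_lt i⟩ ⟨x, Nat.lt_succ_of_le hx.2⟩ ⟨y, Nat.lt_succ_of_le hy.2⟩
      ⟨z, Nat.lt_succ_of_le hz.2⟩ hx.1 hy.1 hz.1 hxyz (not_le.1 hp.2)
  · rintro ⟨π, h⟩
    exact not_stable h
end

section
/- In every anonymous hedonic game in which all agents have naturally single-peaked (possibly weak) preferences over coalition sizes, and for every initial partition, there is no infinite sequence of IS deviations starting from that partition; consequently every maximal sequence of IS deviations terminates in an individually stable partition. -/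
namespace AHG

/-- A sequence through a finite set along which `f` is eventually monotone has
eventually constant `f`-value. -/
lemma eventually_const {α : Type*} [Finite α] (seq : ℕ → α) (f : α → ℚ) (K : ℕ)
    (h : ∀ k, K ≤ k → f (seq k) ≤ f (seq (k + 1))) :
    ∃ K', K ≤ K' ∧ ∀ k, K' ≤ k → f (seq (k + 1)) = f (seq k) := by
  have hmono : ∀ a b, K ≤ a → a ≤ b → f (seq a) ≤ f (seq b) := by
    intro a b ha hab
    induction b, hab using Nat.le_induction with
    | base => exact le_rfl
    | succ b hab ih => exact ih.trans (h b (ha.trans hab))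
  have hfin : ((fun k => f (seq k)) '' Set.Ici K).Finite := by
    apply (Set.finite_range f).subset
    rintro _ ⟨k, _, rfl⟩
    exact ⟨_, rfl⟩
  obtain ⟨m, ⟨K', hK', rfl⟩, hm⟩ :=
    Set.exists_max_image _ id hfin ⟨_, K, Set.mem_Ici.2 le_rfl, rfl⟩
  refine ⟨K', hK', fun k hk => ?_⟩
  have hK'' : K ≤ K' := hK'
  have h1 := hmono K' k hK' hk
  have h2 : f (seq (k + 1)) ≤ f (seq K') := hm _ ⟨k + 1, by simp; omega, rfl⟩
  have h3 := h k (hK''.trans hk)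
  linarith

/-- A utility on sizes `1, …, n` that is unimodal with last peak `p`. -/
structure Peak (u : ℕ → ℕ) (n p : ℕ) : Prop where
  pos : 1 ≤ p
  le : p ≤ n
  mono : ∀ x y, 1 ≤ x → x ≤ y → y ≤ p → u x ≤ u y
  anti : ∀ x y, p ≤ x → x ≤ y → y ≤ n → u y ≤ u x
  strict : ∀ x, p < x → x ≤ n → u x < u p

lemma exists_peak (u : ℕ → ℕ) (n : ℕ) (hn : 1 ≤ n)
    (hu : ∀ x y z, 1 ≤ x → x < y → y < z → z ≤ n → u x ≤ u y ∨ u z ≤ u y) :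
    ∃ p, Peak u n p := by
  classical
  obtain ⟨q, hq, hqm⟩ := Finset.exists_max_image (Finset.Icc 1 n) u ⟨1, by simp [hn]⟩
  obtain ⟨p, hp, hpm⟩ := Finset.exists_max_image
    ((Finset.Icc 1 n).filter (fun x => u q ≤ u x)) id ⟨q, by simp at hq ⊢; exact hq⟩
  simp only [Finset.mem_filter, Finset.mem_Icc, id] at *
  have hmax : ∀ x, 1 ≤ x → x ≤ n → u x ≤ u p := fun x h1 h2 => (hqm x ⟨h1, h2⟩).trans hp.2
  refine ⟨p, hp.1.1, hp.1.2, ?_, ?_, ?_⟩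
  · intro x y hx hxy hy
    rcases hxy.eq_or_lt with rfl | hxy
    · exact le_rfl
    rcases hy.eq_or_lt with rfl | hy
    · exact hmax x hx (by omega)
    rcases hu x y p hx hxy hy hp.1.2 with h | h
    · exact h
    · exact (hmax x hx (by omega)).trans h
  · intro x y hx hxy hy
    rcases hxy.eq_or_lt with rfl | hxy
    · exact le_rfl
    rcases hx.eq_or_lt with rfl | hx
    · exact hmax y (by omega) hy
    rcases hu p x y hp.1.1 hx hxy hy with h | h
    · exact (hmax y (by omega) hy).trans h
    · exact h
  · intro x hx hxn
    by_contra hcon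
    have := hpm x ⟨⟨by omega, hxn⟩, by omega⟩
    omega

/-- Penalty of an agent with utility `u` and last peak `p` in a coalition of size `x`. -/
def pen (P : ℕ) (u : ℕ → ℕ) (p x : ℕ) : ℕ :=
  if P ≤ p ∧ P < x then ((Finset.Icc 1 P).filter (fun y => u x < u y)).card else 0

/-- Weight of the position of height `h`. -/
def wt (P h : ℕ) : ℕ := if h ≤ P then 2 * h else 2 * P + 1

lemma pen_anti (P : ℕ) (u : ℕ → ℕ) (p x y : ℕ) (hx : P < x) (h : u x ≤ u y) :
    pen P u p y ≤ pen P u p x := by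
  unfold pen
  split_ifs with h1 h2 h2
  · apply Finset.card_le_card
    intro z
    simp only [Finset.mem_filter]
    rintro ⟨a, b⟩
    exact ⟨a, by omega⟩
  · exact absurd ⟨h1.1, hx⟩ h2
  · omega
  · omega

lemma pen_zero (P : ℕ) (u : ℕ → ℕ) (p x : ℕ) (h : ∀ y, 1 ≤ y → y ≤ P → P ≤ p → P < x → u y ≤ u x) :
    pen P u p x = 0 := by
  unfold pen
  split_ifs with h1
  · rw [Finset.card_eq_zero, Finset.filter_eq_empty_iff]
    intro y hy
    rw [Finset.mem_Icc] at hy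
    have := h y hy.1 hy.2 h1.1 h1.2
    omega
  · rfl

lemma pen_join {u : ℕ → ℕ} {n p : ℕ} (hp : Peak u n p) (P t : ℕ) (ht : 1 ≤ t)
    (h : u t ≤ u (t + 1)) : pen P u p (t + 1) ≤ pen P u p t := by
  by_cases htP : P < t
  · exact pen_anti P u p t (t + 1) htP h
  · rw [pen_zero P u p (t + 1)]
    · omega
    · intro y h1 h2 h3 h4
      have : t = P := by omega
      subst this
      exact (hp.mono y t h1 h2 h3).trans h

lemma pen_leave {u : ℕ → ℕ} {n p : ℕ} (hp : Peak u n p) (P s : ℕ) (hs : s ≤ n) :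
    pen P u p (s - 1) ≤ pen P u p s := by
  by_cases hsP : P < s - 1
  · by_cases hsp : s ≤ p
    · rw [pen_zero P u p (s - 1)]
      · omega
      · intro y h1 h2 h3 h4
        exact hp.mono _ _ h1 (by omega) (by omega)
    · exact pen_anti P u p s (s - 1) (by omega) (hp.anti _ _ (by omega) (by omega) hs)
  · rw [pen_zero P u p (s - 1)]
    · omega
    · intro y h1 h2 h3 h4
      omega

/-- Contribution of the deviating agent to the change of the potential. -/
lemma pen_move {u : ℕ → ℕ} {n p : ℕ} (hp : Peak u n p) (P s t : ℕ) (hs : 1 ≤ s) (ht : 1 ≤ t)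
    (h : u s < u t) (hP : p < P → s ≤ p ∧ t ≤ p) :
    wt P s + 2 * pen P u p t ≤ wt P t + 2 * pen P u p s ∧
    ((s ≤ P ∨ t ≤ P) → wt P s + 2 * pen P u p t < wt P t + 2 * pen P u p s) := by
  have up : s ≤ p → t ≤ p → s < t := by
    intro h1 h2
    by_contra hc
    have := hp.mono t s ht (by omega) h1
    omega
  by_cases hpP : p < P
  · obtain ⟨h1, h2⟩ := hP hpP
    have := up h1 h2
    have e1 : pen P u p t = 0 := by unfold pen; rw [if_neg]; omega
    have e2 : pen P u p s = 0 := by unfold pen; rw [if_neg]; omega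
    rw [e1, e2]
    unfold wt
    rw [if_pos (by omega), if_pos (by omega)]
    omega
  have hPp : P ≤ p := by omega
  by_cases hsP : s ≤ P <;> by_cases htP : t ≤ P
  · have := up (by omega) (by omega)
    have e1 : pen P u p t = 0 := by unfold pen; rw [if_neg]; omega
    have e2 : pen P u p s = 0 := by unfold pen; rw [if_neg]; omega
    rw [e1, e2]
    unfold wt
    rw [if_pos (by omega), if_pos (by omega)]
    omega
  · have e1 : pen P u p t ≤ P - s := by
      unfold pen
      rw [if_pos ⟨hPp, by omega⟩]
      calc _ ≤ (Finset.Icc (s + 1) P).card := by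
            apply Finset.card_le_card
            intro y
            simp only [Finset.mem_filter, Finset.mem_Icc]
            rintro ⟨⟨a, b⟩, c⟩
            refine ⟨?_, b⟩
            by_contra hc
            have := hp.mono y s a (by omega) (by omega)
            omega
        _ = P - s := by simp
    unfold wt
    rw [if_pos hsP, if_neg htP]
    omega
  · have e1 : P + 1 - t ≤ pen P u p s := by
      unfold pen
      rw [if_pos ⟨hPp, by omega⟩]
      calc P + 1 - t = (Finset.Icc t P).card := by simp
        _ ≤ _ := by
            apply Finset.card_le_card
            intro y
            simp only [Finset.mem_filter, Finset.mem_Icc]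
            rintro ⟨a, b⟩
            refine ⟨⟨by omega, b⟩, ?_⟩
            have := hp.mono t y ht a (by omega)
            omega
    have e2 : pen P u p t = 0 := by unfold pen; rw [if_neg]; omega
    rw [e2]
    unfold wt
    rw [if_neg hsP, if_pos htP]
    omega
  · have := pen_anti P u p s t (by omega) h.le
    unfold wt
    rw [if_neg hsP, if_neg htP]
    omega

/-- Size-level description of a deviation of agent `i`. -/
structure Dev {A : Type} (u : A → ℕ → ℕ) (c c' : A → ℕ) (i : A) (S T : Finset A) : Prop where
  mem : i ∈ S
  disj : Disjoint S T
  cS : ∀ a ∈ S, c a = S.card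
  cT : ∀ a ∈ T, c a = T.card
  cS' : ∀ a ∈ S, a ≠ i → c' a = S.card - 1
  cT' : ∀ a ∈ T, c' a = T.card + 1
  acc : ∀ a ∈ T, u a T.card ≤ u a (T.card + 1)
  ci' : c' i = T.card + 1
  rest : ∀ a, a ∉ S → a ∉ T → c' a = c a
  better : u i S.card < u i (T.card + 1)

/-- Total weight of a coalition of size `x`. -/
def tot (P x : ℕ) : ℚ := ∑ h ∈ Finset.range x, (wt P (h + 1) : ℚ)

/-- The potential. -/
noncomputable def pot {A : Type} [Fintype A] (P : ℕ) (u : A → ℕ → ℕ) (p : A → ℕ) (c : A → ℕ) : ℚ :=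
  ∑ a, tot P (c a) / (c a : ℚ) - 2 * ∑ a, (pen P (u a) (p a) (c a) : ℚ)

lemma sum_const_tot {A : Type} (P : ℕ) (S : Finset A) (f : A → ℕ) (m : ℕ) (hm : S.card = m)
    (h : ∀ a ∈ S, f a = m) : ∑ a ∈ S, tot P (f a) / (f a : ℚ) = tot P m := by
  rw [Finset.sum_congr rfl (fun a ha => by rw [h a ha]), Finset.sum_const, hm, nsmul_eq_mul]
  rcases Nat.eq_zero_or_pos m with rfl | h0
  · simp [tot]
  · have : (m : ℚ) ≠ 0 := by positivity
    field_simp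

lemma tot_step {A : Type} [Fintype A] [DecidableEq A] {u : A → ℕ → ℕ} {c c' : A → ℕ} {i : A}
    {S T : Finset A} (D : Dev u c c' i S T) (P : ℕ) :
    ∑ a, tot P (c' a) / (c' a : ℚ) + wt P S.card
      = ∑ a, tot P (c a) / (c a : ℚ) + wt P (T.card + 1) := by
  have split1 : ∀ f : A → ℚ, ∑ a, f a = ∑ a ∈ S, f a + ∑ a ∈ T, f a + ∑ a ∈ (S ∪ T)ᶜ, f a := by
    intro f
    rw [← Finset.sum_union D.disj, Finset.sum_add_sum_compl]
  have hiT : i ∉ T := Finset.disjoint_left.1 D.disj D.mem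
  have split2 : ∀ f : A → ℚ, ∑ a, f a
      = ∑ a ∈ S.erase i, f a + ∑ a ∈ insert i T, f a + ∑ a ∈ (S ∪ T)ᶜ, f a := by
    intro f
    rw [split1, Finset.sum_insert hiT, ← Finset.sum_erase_add S f D.mem]
    ring
  rw [split2, split1 (fun a => tot P (c a) / (c a : ℚ))]
  have hrest : ∑ a ∈ (S ∪ T)ᶜ, tot P (c' a) / (c' a : ℚ) = ∑ a ∈ (S ∪ T)ᶜ, tot P (c a) / (c a : ℚ) := by
    apply Finset.sum_congr rfl
    intro a ha
    simp only [Finset.mem_compl, Finset.mem_union, not_or] at ha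
    rw [D.rest a ha.1 ha.2]
  rw [hrest, sum_const_tot P S c _ rfl D.cS, sum_const_tot P T c _ rfl D.cT,
    sum_const_tot P (S.erase i) c' (S.card - 1) (Finset.card_erase_of_mem D.mem)
      (fun a ha => D.cS' a (Finset.mem_of_mem_erase ha) (Finset.ne_of_mem_erase ha)),
    sum_const_tot P (insert i T) c' (T.card + 1) (Finset.card_insert_of_notMem hiT)
      (fun a ha => by
        rcases Finset.mem_insert.1 ha with rfl | ha
        · exact D.ci'
        · exact D.cT' a ha)]
  have hs : 1 ≤ S.card := Finset.card_pos.2 ⟨i, D.mem⟩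
  obtain ⟨s, hs'⟩ : ∃ s, S.card = s + 1 := ⟨S.card - 1, by omega⟩
  rw [hs']
  simp only [Nat.add_sub_cancel]
  unfold tot
  rw [Finset.sum_range_succ _ s, Finset.sum_range_succ _ T.card]
  ring

lemma pot_step {A : Type} [Fintype A] [DecidableEq A] {u : A → ℕ → ℕ} {p : A → ℕ} {n : ℕ}
    (hp : ∀ a, Peak (u a) n (p a)) {c c' : A → ℕ} {i : A} {S T : Finset A}
    (D : Dev u c c' i S T) (hS : S.card ≤ n) (P : ℕ)
    (hP : p i < P → c i ≤ p i ∧ c' i ≤ p i) :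
    pot P u p c ≤ pot P u p c' ∧ ((c i ≤ P ∨ c' i ≤ P) → pot P u p c < pot P u p c') := by
  have hs : 1 ≤ S.card := Finset.card_pos.2 ⟨i, D.mem⟩
  have h1 := tot_step D P
  have hother : ∑ a ∈ Finset.univ.erase i, (pen P (u a) (p a) (c' a) : ℚ)
      ≤ ∑ a ∈ Finset.univ.erase i, (pen P (u a) (p a) (c a) : ℚ) := by
    apply Finset.sum_le_sum
    intro a ha
    have hai := Finset.ne_of_mem_erase ha
    norm_cast
    by_cases haS : a ∈ S
    · rw [D.cS' a haS hai, D.cS a haS]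
      exact pen_leave (hp a) P _ hS
    by_cases haT : a ∈ T
    · rw [D.cT' a haT, D.cT a haT]
      exact pen_join (hp a) P _ (Finset.card_pos.2 ⟨a, haT⟩) (D.acc a haT)
    rw [D.rest a haS haT]
  have ci : c i = S.card := D.cS i D.mem
  rw [ci, D.ci'] at hP
  have h2 := pen_move (hp i) P S.card (T.card + 1) hs (by omega) D.better hP
  have e1 := Finset.sum_erase_add Finset.univ
    (fun a => (pen P (u a) (p a) (c a) : ℚ)) (Finset.mem_univ i)
  have e2 := Finset.sum_erase_add Finset.univ
    (fun a => (pen P (u a) (p a) (c' a) : ℚ)) (Finset.mem_univ i)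
  simp only [ci, D.ci'] at e1 e2 ⊢
  unfold pot
  refine ⟨?_, fun h => ?_⟩
  · have h3 := h2.1
    have h4 : (wt P S.card : ℚ) + 2 * (pen P (u i) (p i) (T.card + 1) : ℚ)
      ≤ wt P (T.card + 1) + 2 * (pen P (u i) (p i) S.card : ℚ) := by exact_mod_cast h3
    linarith
  · have h3 := h2.2 h
    have h4 : (wt P S.card : ℚ) + 2 * (pen P (u i) (p i) (T.card + 1) : ℚ)
      < wt P (T.card + 1) + 2 * (pen P (u i) (p i) S.card : ℚ) := by exact_mod_cast h3
    linarith

/-- Partition-level to size-level. -/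
lemma dev_of_isDeviation {A : Type} [Fintype A] [DecidableEq A] (sp : A → ℕ → ℕ → Prop)
    (u : A → ℕ → ℕ)
    (hu : ∀ a x y, 1 ≤ x → x ≤ Fintype.card A → 1 ≤ y → y ≤ Fintype.card A →
      (sp a x y ↔ u a y ≤ u a x))
    {π π' : A → Finset A} (h1 : IsPartition π) (h2 : IsPartition π') {i : A}
    (h : IsISDeviation (ahgPref sp) π π' i) :
    Dev u (fun a => (π a).card) (fun a => (π' a).card) i (π i) ((π' i).erase i) := by
  obtain ⟨hne, her, hst, hacc⟩ := h
  have hT : ∀ j ∈ (π' i).erase i, π j = (π' i).erase i := by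
    intro j hj
    have hji := Finset.ne_of_mem_erase hj
    have e := h2.2 j i (Finset.mem_of_mem_erase hj)
    have e2 := her j hji
    rw [e] at e2
    by_cases hi : i ∈ π j
    · exfalso
      rw [← h1.2 i j hi] at e2
      apply hne
      rw [← Finset.insert_erase (h2.1 i), e2, Finset.insert_erase (h1.1 i)]
    · rw [e2, Finset.erase_eq_of_notMem hi]
  have hd : Disjoint (π i) ((π' i).erase i) := by
    rw [Finset.disjoint_left]
    intro j hj hj'
    have e := hT j hj'
    rw [h1.2 j i hj] at e
    have := h1.1 i
    rw [e] at this
    simp at this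
  have hci : (π' i).card = ((π' i).erase i).card + 1 :=
    (Finset.card_erase_add_one (h2.1 i)).symm
  have pos : ∀ {π : A → Finset A}, IsPartition π → ∀ a, 1 ≤ (π a).card :=
    fun hπ a => Finset.card_pos.2 ⟨a, hπ.1 a⟩
  have le : ∀ s : Finset A, s.card ≤ Fintype.card A := fun s => Finset.card_le_univ s
  refine ⟨h1.1 i, hd, ?_, ?_, ?_, ?_, ?_, hci, ?_, ?_⟩
  · intro a ha
    simp only [h1.2 a i ha]
  · intro a ha
    simp only [hT a ha]
  · intro a ha hai
    have e := her a hai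
    rw [h1.2 a i ha] at e
    have hi : i ∉ π' a := by
      intro hi
      have e3 := h2.2 i a hi
      apply Finset.disjoint_left.1 hd ha
      rw [Finset.mem_erase, e3]
      exact ⟨hai, h2.1 a⟩
    rw [Finset.erase_eq_of_notMem hi] at e
    simp only [e]
    exact Finset.card_erase_of_mem (h1.1 i)
  · intro a ha
    simp only [h2.2 a i (Finset.mem_of_mem_erase ha)]
    exact hci
  · intro a ha
    have e := hacc a ha
    unfold ahgPref at e
    rw [hu a _ _ (pos h2 a) (le _) (pos h1 a) (le _), hT a ha,
      h2.2 a i (Finset.mem_of_mem_erase ha), hci] at e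
    exact e
  · intro a haS haT
    have hai : a ≠ i := by
      rintro rfl
      exact haS (h1.1 a)
    have e := her a hai
    have n1 : i ∉ π a := fun hi => haS (by rw [h1.2 i a hi]; exact h1.1 a)
    have n2 : i ∉ π' a := fun hi => haT (by
      rw [Finset.mem_erase, h2.2 i a hi]
      exact ⟨hai, h2.1 a⟩)
    rw [Finset.erase_eq_of_notMem n1, Finset.erase_eq_of_notMem n2] at e
    simp only [e]
  · have e := hst.2
    unfold ahgPref at e
    rw [hu i _ _ (pos h1 i) (le _) (pos h2 i) (le _), hci] at e
    omega

/-- Representation of a weak order on `1, …, n` by a utility. -/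
lemma exists_utility (r : ℕ → ℕ → Prop) (n : ℕ) (hr : WeakOrderOn r (Set.Icc 1 n)) :
    ∃ u : ℕ → ℕ, ∀ x y, 1 ≤ x → x ≤ n → 1 ≤ y → y ≤ n → (r x y ↔ u y ≤ u x) := by
  classical
  refine ⟨fun x => ((Finset.Icc 1 n).filter (fun z => r x z)).card, ?_⟩
  intro x y hx1 hx2 hy1 hy2
  have hx : x ∈ Set.Icc 1 n := ⟨hx1, hx2⟩
  have hy : y ∈ Set.Icc 1 n := ⟨hy1, hy2⟩
  have refl : ∀ z ∈ Set.Icc 1 n, r z z := fun z hz => (hr.1 z hz z hz).elim id id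
  constructor
  · intro h
    apply Finset.card_le_card
    intro z
    simp only [Finset.mem_filter, Finset.mem_Icc]
    rintro ⟨hz, hyz⟩
    exact ⟨hz, hr.2 x hx y hy z hz h hyz⟩
  · intro h
    by_contra hxy
    have hyx : r y x := (hr.1 x hx y hy).resolve_left hxy
    apply absurd h
    rw [not_le]
    apply Finset.card_lt_card
    rw [Finset.ssubset_iff_of_subset]
    · refine ⟨y, ?_, ?_⟩
      · simp only [Finset.mem_filter, Finset.mem_Icc]
        exact ⟨hy, refl y hy⟩
      · simp [hxy]
    · intro z
      simp only [Finset.mem_filter, Finset.mem_Icc]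
      rintro ⟨hz, hxz⟩
      exact ⟨hz, hr.2 y hy x hx z hz hyx hxz⟩

lemma no_infinite {A : Type} [Fintype A] [DecidableEq A] (u : A → ℕ → ℕ) (p : A → ℕ) (n : ℕ)
    (hp : ∀ a, Peak (u a) n (p a)) (seq : ℕ → A → Finset A)
    (hn : ∀ k a, (seq k a).card ≤ n)
    (m : ℕ → A) (S T : ℕ → Finset A)
    (D : ∀ k, Dev u (fun a => (seq k a).card) (fun a => (seq (k + 1) a).card) (m k) (S k) (T k)) :
    False := by
  have hS : ∀ k, (S k).card ≤ n := fun k => by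
    rw [← (D k).cS (m k) (D k).mem]
    exact hn k _
  -- consequence of the induction hypothesis
  have key : ∀ P K, (∀ k, K ≤ k → p (m k) < P →
      (seq k (m k)).card ≤ p (m k) ∧ (seq (k + 1) (m k)).card ≤ p (m k)) →
      ∃ K', K ≤ K' ∧ ∀ k, K' ≤ k →
        P < (seq k (m k)).card ∧ P < (seq (k + 1) (m k)).card := by
    intro P K hK
    obtain ⟨K', h1, h2⟩ := eventually_const seq (fun π => pot P u p (fun a => (π a).card)) K
      (fun k hk => (pot_step hp (D k) (hS k) P (hK k hk)).1)
    refine ⟨K', h1, fun k hk => ?_⟩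
    have h3 := (pot_step hp (D k) (hS k) P (hK k (h1.trans hk))).2
    have h4 := h2 k hk
    by_contra hc
    have := h3 (by omega)
    linarith
  have main : ∀ P, ∃ K, ∀ k, K ≤ k → p (m k) < P →
      (seq k (m k)).card ≤ p (m k) ∧ (seq (k + 1) (m k)).card ≤ p (m k) := by
    intro P
    induction P with
    | zero => exact ⟨0, fun k _ h => by omega⟩
    | succ P ih =>
      obtain ⟨K, hK⟩ := ih
      obtain ⟨K', hKK', hK'⟩ := key P K hK
      have each : ∀ a, ∃ Ka, p a = P → ∀ k, Ka ≤ k → m k = a →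
          (seq k a).card ≤ p a ∧ (seq (k + 1) a).card ≤ p a := by
        intro a
        by_cases hpa : p a = P
        swap
        · exact ⟨0, fun h => absurd h hpa⟩
        -- once below the peak, the agent stays there
        have stay : ∀ k, K' ≤ k → (seq k a).card ≤ P → (seq (k + 1) a).card ≤ P := by
          intro k hk hle
          have hm := hK' k hk
          by_cases ham : a = m k
          · rw [← ham] at hm
            omega
          by_cases haS : a ∈ S k
          · have e1 := (D k).cS a haS
            have e2 := (D k).cS' a haS ham
            omega
          by_cases haT : a ∈ T k
          · have e1 := (D k).cT a haT
            have e2 := (D k).cT' a haT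
            have e3 := (D k).acc a haT
            have e4 := hn (k + 1) a
            by_contra hc
            have e5 : (T k).card = p a := by omega
            rw [e5] at e3
            have := (hp a).strict (p a + 1) (by omega) (by omega)
            omega
          · have e1 := (D k).rest a haS haT
            omega
        by_cases hex : ∃ k, K' ≤ k ∧ (seq k a).card ≤ P
        · obtain ⟨k0, hk0, hle⟩ := hex
          have hall : ∀ k, k0 ≤ k → (seq k a).card ≤ P := by
            intro k hk
            induction k, hk using Nat.le_induction with
            | base => exact hle
            | succ k hk ih => exact stay k (hk0.trans hk) ih
          exact ⟨k0, fun _ k hk _ => by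
            rw [hpa]; exact ⟨hall k hk, hall (k + 1) (by omega)⟩⟩
        · push Not at hex
          obtain ⟨K2, hK2, hc⟩ := eventually_const seq (fun π => (u a (π a).card : ℚ)) K' (by
            intro k hk
            have hlt := hex k hk
            have hlt' := hex (k + 1) (by omega)
            norm_cast
            by_cases haS : a ∈ S k
            · have e1 := (D k).cS a haS
              by_cases ham : a = m k
              · have e2 := (D k).ci'
                have e3 := (D k).better
                rw [← ham] at e2 e3
                rw [e1, e2]
                exact e3.le
              · have e2 := (D k).cS' a haS ham
                exact (hp a).anti _ _ (by omega) (by omega) (hn _ _)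
            by_cases haT : a ∈ T k
            · have e1 := (D k).cT a haT
              have e2 := (D k).cT' a haT
              have e3 := (D k).acc a haT
              rw [e1, e2]
              exact e3
            · have e1 := (D k).rest a haS haT
              rw [e1])
          refine ⟨K2, fun _ k hk hma => ?_⟩
          exfalso
          have e0 := hc k hk
          have e1 := (D k).cS (m k) (D k).mem
          have e2 := (D k).ci'
          have e3 := (D k).better
          rw [hma] at e1 e2 e3
          simp only [Nat.cast_inj] at e0
          rw [e1, e2] at e0
          omega
      choose Ka hKa using each
      refine ⟨max K (Finset.univ.sup Ka), fun k hk hlt => ?_⟩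
      rcases Nat.lt_succ_iff_lt_or_eq.1 hlt with h | h
      · exact hK k (le_trans (le_max_left _ _) hk) h
      · exact hKa (m k) h k (le_trans (Finset.le_sup (f := Ka) (Finset.mem_univ _))
          (le_trans (le_max_right _ _) hk)) rfl
  obtain ⟨K, hK⟩ := main n
  obtain ⟨K', _, hK'⟩ := key n K hK
  have h1 := (hK' K' le_rfl).1
  have h2 := hn K' (m K')
  omega

end AHG

/-- In every anonymous hedonic game with naturally single-peaked (possibly weak)
preferences, there is no infinite sequence of IS deviations from any initial
partition; consequently every maximal sequence of IS deviations terminates in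
an individually stable partition. -/
theorem ahg_natSP_no_infinite_IS_sequence
    (A : Type) [Fintype A] [DecidableEq A]
    (sp : A → ℕ → ℕ → Prop)
    (hwo : ∀ i, WeakOrderOn (sp i) (Set.Icc 1 (Fintype.card A)))
    (hsp : ∀ i, SinglePeakedOn (sp i) (Set.Icc 1 (Fintype.card A))) :
    (∀ π0 : A → Finset A, IsPartition π0 →
      ¬ ∃ seq : ℕ → A → Finset A, seq 0 = π0 ∧
        ∀ k, ISStep (ahgPref sp) (seq k) (seq (k + 1))) ∧
    (∀ π : A → Finset A, IsPartition π →
      (∀ π' : A → Finset A, ¬ ISStep (ahgPref sp) π π') →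
      IndividuallyStable (ahgPref sp) π) := by
  refine ⟨?_, fun π h1 h2 => ⟨h1, h2⟩⟩
  rintro π0 - ⟨seq, -, hstep⟩
  choose u hu using fun a => AHG.exists_utility (sp a) (Fintype.card A) (hwo a)
  choose h1 h2 m hm using hstep
  have hn : 1 ≤ Fintype.card A := Fintype.card_pos_iff.2 ⟨m 0⟩
  have hpeak : ∀ a, ∃ p, AHG.Peak (u a) (Fintype.card A) p := by
    intro a
    apply AHG.exists_peak _ _ hn
    intro x y z hx hxy hyz hz
    by_contra hc
    push Not at hc
    have hr := hsp a x ⟨hx, by omega⟩ y ⟨by omega, by omega⟩ z ⟨by omega, hz⟩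
      (Or.inl ⟨hxy, hyz⟩) ⟨(hu a x y hx (by omega) (by omega) (by omega)).2 hc.1.le, fun h => by
        have := (hu a y x (by omega) (by omega) hx (by omega)).1 h
        omega⟩
    have := (hu a y z (by omega) (by omega) (by omega) hz).1 hr
    omega
  choose p hp using hpeak
  exact AHG.no_infinite u p (Fintype.card A) hp seq (fun k a => Finset.card_le_univ _) m _ _
    (fun k => AHG.dev_of_isDeviation sp u hu (h1 k) (h2 k) (hm k))
end

section
/- There exists a hedonic diversity game in which all agents have strict and naturally single-peaked preferences, and an initial partition (not the singleton partition), that admits an infinite sequence of IS deviations starting from that initial partition in which every deviation satisfies solitary homogeneity. -/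
/-- The fraction of red agents (members of `R`) in the coalition `C`. -/
def redRatio {A : Type*} [DecidableEq A] (R : Finset A) (C : Finset A) : ℚ :=
  ((R ∩ C).card : ℚ) / (C.card : ℚ)

/-- The set of ratios `p/q` with `0 ≤ p ≤ r` and `1 ≤ q ≤ n`. -/
def RatioSet (r n : ℕ) : Set ℚ :=
  {x : ℚ | ∃ p q : ℕ, p ≤ r ∧ 1 ≤ q ∧ q ≤ n ∧ x = (p : ℚ) / (q : ℚ)}

/-- Coalition preferences of a hedonic diversity game with red agents `R`:
coalitions are compared by their fraction of red agents via the ratio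
preferences `rp`. -/
def hdgPref {A : Type*} [DecidableEq A] (R : Finset A) (rp : A → ℚ → ℚ → Prop) :
    A → Finset A → Finset A → Prop :=
  fun i C D => rp i (redRatio R C) (redRatio R D)

/-- A coalition is homogeneous if it consists only of red agents or only of
blue agents. -/
def HomogeneousCoalition {A : Type*} [DecidableEq A] (R : Finset A) (C : Finset A) : Prop :=
  C ⊆ R ∨ ∀ a ∈ C, a ∉ R

/-- One step of the dynamics of IS deviations in a hedonic diversity game in
which the deviation satisfies solitary homogeneity: if the target coalition of
the deviator is homogeneous, then it is a singleton. -/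
def ISStepSH {A : Type*} [DecidableEq A] (R : Finset A) (rp : A → ℚ → ℚ → Prop)
    (π π' : A → Finset A) : Prop :=
  IsPartition π ∧ IsPartition π' ∧
  ∃ i, IsISDeviation (hdgPref R rp) π π' i ∧
    (HomogeneousCoalition R (π' i) → (π' i).card = 1)

/-- Label of the fixed coalition containing a non-deviating agent; agents `0, 1` (red) and
`2, 3` (blue) are the deviators and get their label from the state `s`. -/
def cycLabel (s : ℕ × ℕ × ℕ × ℕ) (i : Fin 26) : ℕ :=
  if i.val = 0 then s.1 else if i.val = 1 then s.2.1 else if i.val = 2 then s.2.2.1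
  else if i.val = 3 then s.2.2.2 else if i.val < 10 then 0 else if i.val < 15 then 1
  else if i.val < 20 then 2 else 3

/-- Positions of the four deviators along the cycle of length eight. -/
def cycState (k : ℕ) : ℕ × ℕ × ℕ × ℕ :=
  match k with
  | 0 => (0, 2, 0, 1)
  | 1 => (0, 3, 0, 1)
  | 2 => (3, 3, 0, 1)
  | 3 => (3, 3, 0, 2)
  | 4 => (3, 2, 0, 2)
  | 5 => (3, 2, 1, 2)
  | 6 => (0, 2, 1, 2)
  | _ => (0, 2, 1, 1)

/-- The deviating agent at each step. -/
def cycDev (k : ℕ) : Fin 26 :=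
  match k with
  | 0 => 1
  | 1 => 0
  | 2 => 3
  | 3 => 1
  | 4 => 2
  | 5 => 0
  | 6 => 3
  | _ => 2

/-- The partition with a given labelling. -/
def labelPart (l : Fin 26 → ℕ) (i : Fin 26) : Finset (Fin 26) :=
  Finset.univ.filter (fun j => l j = l i)

theorem labelPart_isPartition (l : Fin 26 → ℕ) : IsPartition (labelPart l) := by
  constructor
  · intro i; simp [labelPart]
  · intro i j h
    simp only [labelPart, Finset.mem_filter, Finset.mem_univ, true_and] at h
    simp [labelPart, h]

/-- The red agents. -/
def cycRed : Finset (Fin 26) := {0, 1, 4, 5, 10, 11, 12, 13, 14, 15, 16, 17}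

/-- Tent-shaped utility with peak `p`. -/
def tent (p c x : ℚ) : ℚ := min (c * (x - p)) (p - x)

/-- Preference induced by a tent utility, ties broken in favour of larger ratios. -/
def tentPref (p c x y : ℚ) : Prop :=
  tent p c y < tent p c x ∨ (tent p c y = tent p c x ∧ y ≤ x)

instance tentPrefDec (p c x y : ℚ) : Decidable (tentPref p c x y) := by
  unfold tentPref; infer_instance

/-- Peak and left slope of each agent. -/
def cycPar (i : Fin 26) : ℚ × ℚ :=
  if i.val = 0 then (1/4, 2) else if i.val = 1 then (4/7, 1/5)
  else if i.val = 2 then (3/8, 6) else if i.val = 3 then (5/7, 1/2)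
  else if i.val < 10 then (3/8, 2) else if i.val < 15 then (0, 1)
  else if i.val < 20 then (4/7, 1/5) else (1, 1)

theorem cycPar_pos (i : Fin 26) : 0 < (cycPar i).2 := by
  unfold cycPar; split_ifs <;> norm_num

/-- The preferences of the game. -/
def cycPref (i : Fin 26) : ℚ → ℚ → Prop := tentPref (cycPar i).1 (cycPar i).2

instance cycPrefDec (i : Fin 26) (x y : ℚ) : Decidable (cycPref i x y) :=
  tentPrefDec _ _ _ _

theorem tent_right {p c x y : ℚ} (hc : 0 < c) (hx : p ≤ x) (hxy : x < y) :
    tent p c y < tent p c x := by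
  unfold tent
  have h1 : p - x ≤ c * (x - p) := by
    have := mul_nonneg hc.le (sub_nonneg.2 hx); linarith
  rw [min_eq_right h1]
  exact lt_of_le_of_lt (min_le_right _ _) (by linarith)

theorem tent_left {p c x y : ℚ} (hc : 0 < c) (hx : x ≤ p) (hxy : y < x) :
    tent p c y < tent p c x := by
  unfold tent
  have h1 : c * (x - p) ≤ p - x := by
    have := mul_nonneg hc.le (sub_nonneg.2 hx); linarith
  rw [min_eq_left h1]
  exact lt_of_le_of_lt (min_le_left _ _) (mul_lt_mul_of_pos_left (by linarith) hc)

theorem tentPref_sp {p c x y z : ℚ} (hc : 0 < c)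
    (h : (x < y ∧ y < z) ∨ (z < y ∧ y < x)) (hxy : tentPref p c x y) : tentPref p c y z := by
  left
  rcases h with ⟨h1, h2⟩ | ⟨h1, h2⟩
  · refine tent_right hc ?_ h2
    by_contra hp
    have := tent_left hc (not_le.1 hp).le h1
    rcases hxy with h | ⟨h, -⟩ <;> linarith
  · refine tent_left hc ?_ h1
    by_contra hp
    have := tent_right hc (not_le.1 hp).le h2
    rcases hxy with h | ⟨h, -⟩ <;> linarith

/-- The cycle of partitions. -/
def cycPart (k : ℕ) : Fin 26 → Finset (Fin 26) := labelPart (cycLabel (cycState (k % 8)))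

set_option maxRecDepth 100000 in
theorem cyc_step (k : Fin 8) :
    let P := labelPart (cycLabel (cycState k.val))
    let Q := labelPart (cycLabel (cycState ((k.val + 1) % 8)))
    let i := cycDev k.val
    (Q i ≠ P i ∧ (∀ j, j ≠ i → (Q j).erase i = (P j).erase i) ∧
      (cycPref i (redRatio cycRed (Q i)) (redRatio cycRed (P i)) ∧
        ¬ cycPref i (redRatio cycRed (P i)) (redRatio cycRed (Q i))) ∧
      ∀ j ∈ (Q i).erase i, cycPref j (redRatio cycRed (Q j)) (redRatio cycRed (P j))) ∧
    ¬ (Q i ⊆ cycRed ∨ ∀ a ∈ Q i, a ∉ cycRed) := by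
  revert k
  unfold redRatio
  decide +kernel

/-- There exists a hedonic diversity game with strict and naturally
single-peaked preferences, and an initial partition different from the
singleton partition, admitting an infinite sequence of IS deviations from that
initial partition in which every deviation satisfies solitary homogeneity. -/
theorem hdg_strict_natSP_cycle_SH :
    ∃ (n : ℕ) (R : Finset (Fin n)) (rp : Fin n → ℚ → ℚ → Prop),
      (∀ i, WeakOrderOn (rp i) (RatioSet R.card n)) ∧
      (∀ i, StrictPrefsOn (rp i) (RatioSet R.card n)) ∧
      (∀ i, SinglePeakedOn (rp i) (RatioSet R.card n)) ∧
      ∃ π0 : Fin n → Finset (Fin n),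
        IsPartition π0 ∧ π0 ≠ (fun a => {a}) ∧
        ∃ seq : ℕ → Fin n → Finset (Fin n),
          seq 0 = π0 ∧
          ∀ k, ISStepSH R rp (seq k) (seq (k + 1)) := by
  refine ⟨26, cycRed, cycPref, ?_, ?_, ?_, cycPart 0, labelPart_isPartition _, ?_, cycPart, rfl, ?_⟩
  · intro i
    refine ⟨fun x _ y _ => ?_, fun x _ y _ z _ h1 h2 => ?_⟩
    · unfold cycPref tentPref
      rcases lt_trichotomy (tent (cycPar i).1 (cycPar i).2 x) (tent (cycPar i).1 (cycPar i).2 y)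
        with h | h | h
      · exact Or.inr (Or.inl h)
      · rcases le_total x y with h' | h'
        · exact Or.inr (Or.inr ⟨h, h'⟩)
        · exact Or.inl (Or.inr ⟨h.symm, h'⟩)
      · exact Or.inl (Or.inl h)
    · unfold cycPref tentPref at *
      rcases h1 with h1 | ⟨h1, h1'⟩ <;> rcases h2 with h2 | ⟨h2, h2'⟩
      · left; linarith
      · left; linarith
      · left; linarith
      · right; exact ⟨h2.trans h1, h2'.trans h1'⟩
  · intro i x _ y _ h1 h2
    unfold cycPref tentPref at *
    rcases h1 with h1 | ⟨h1, h1'⟩ <;> rcases h2 with h2 | ⟨h2, h2'⟩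
    · linarith
    · linarith
    · linarith
    · linarith
  · intro i x _ y _ z _ h hxy
    exact tentPref_sp (cycPar_pos i) h hxy.1
  · intro h
    have h1 := congrFun h 10
    have h2 : (11 : Fin 26) ∈ cycPart 0 10 := by decide +kernel
    rw [h1] at h2
    revert h2
    decide
  · intro k
    refine ⟨labelPart_isPartition _, labelPart_isPartition _, cycDev (k % 8), ?_⟩
    have h := cyc_step ⟨k % 8, Nat.mod_lt _ (by norm_num)⟩
    have e : (k % 8 + 1) % 8 = (k + 1) % 8 := by omega
    simp only [e] at h
    exact ⟨h.1, fun hh => absurd hh h.2⟩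
end

section
/- There exists a hedonic diversity game in which all agents have strict and naturally single-peaked preferences that admits an infinite sequence of IS deviations starting from the singleton partition (where the deviations are not required to satisfy solitary homogeneity). -/
/-- Piecewise linear single-peaked utility with peak `p`, left slope `a`, right slope `b`. -/
def util (a b p x : ℚ) : ℚ := if x ≤ p then a * (x - p) else b * (p - x)

/-- The strict order induced by `util`, ties broken towards smaller ratios. -/
def utilPref (a b p x y : ℚ) : Prop :=
  util a b p y < util a b p x ∨ (util a b p x = util a b p y ∧ x ≤ y)

instance (a b p x y : ℚ) : Decidable (utilPref a b p x y) := by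
  unfold utilPref; infer_instance

theorem utilPref_weak (a b p : ℚ) (S : Set ℚ) : WeakOrderOn (utilPref a b p) S := by
  refine ⟨fun x _ y _ => ?_, fun x _ y _ z _ => ?_⟩
  · unfold utilPref
    rcases lt_trichotomy (util a b p x) (util a b p y) with h | h | h
    · exact Or.inr (Or.inl h)
    · rcases le_total x y with h' | h'
      · exact Or.inl (Or.inr ⟨h, h'⟩)
      · exact Or.inr (Or.inr ⟨h.symm, h'⟩)
    · exact Or.inl (Or.inl h)
  · unfold utilPref
    rintro (h | ⟨h, h'⟩) (k | ⟨k, k'⟩)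
    · exact Or.inl (k.trans h)
    · exact Or.inl (k ▸ h)
    · exact Or.inl (h ▸ k)
    · exact Or.inr ⟨h.trans k, h'.trans k'⟩

theorem utilPref_strict (a b p : ℚ) (S : Set ℚ) : StrictPrefsOn (utilPref a b p) S := by
  intro x _ y _
  unfold utilPref
  rintro (h | ⟨h, h'⟩) (k | ⟨k, k'⟩)
  · exact absurd h k.not_gt
  · exact absurd k h.ne
  · exact absurd h k.ne
  · exact le_antisymm h' k'

theorem utilPref_sp (a b p : ℚ) (ha : 0 < a) (hb : 0 < b) (S : Set ℚ) :
    SinglePeakedOn (utilPref a b p) S := by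
  intro x _ y _ z _ hxyz hs
  have h1 : util a b p y ≤ util a b p x := by
    rcases hs.1 with h | h
    · exact h.le
    · exact h.1.ge
  left
  unfold util at *
  rcases hxyz with ⟨h, k⟩ | ⟨k, h⟩
  · split_ifs at * <;> nlinarith
  · split_ifs at * <;> nlinarith

/-- Red agents. -/
def redAgents : Finset (Fin 15) := {0, 2, 5, 7, 9, 10, 12}

/-- Left slope, right slope and peak of every agent. -/
def params : Fin 15 → ℚ × ℚ × ℚ :=
  ![(1, 1, 1/3), (1, 2, 3/10), (1, 1, 2/3), (2, 1, 1/2), (2, 1, 1/2),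
    (2, 1, 7/10), (1, 1, 2/3), (1, 2, 3/4), (1, 1, 3/4), (1, 2, 3/4),
    (1, 2, 3/4), (2, 1, 1/4), (1, 1, 1/4), (2, 1, 1/4), (2, 1, 1/4)]

/-- The preferences of the game. -/
def gamePref (i : Fin 15) : ℚ → ℚ → Prop :=
  utilPref (params i).1 (params i).2.1 (params i).2.2

instance (i : Fin 15) (x y : ℚ) : Decidable (gamePref i x y) := by
  unfold gamePref; infer_instance

/-- The moves: 13 preparatory moves, followed by a cycle of 8 moves. In the move `(i, l)`
agent `i` goes to the coalition with label `l`. -/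
def moves : List (Fin 15 × Fin 15) :=
  [(9, 8), (10, 8), (7, 6), (5, 6), (7, 8), (5, 2), (13, 12), (14, 12), (11, 0), (1, 0),
   (11, 12), (1, 4), (3, 2),
   (3, 0), (0, 4), (4, 2), (1, 0), (4, 4), (0, 0), (3, 2), (1, 4)]

/-- Labels after the first `m` moves. -/
def labels (m : ℕ) : Fin 15 → Fin 15 :=
  (moves.take m).foldl (fun f mv => Function.update f mv.1 mv.2) id

/-- The partition induced by a labelling. -/
def partOf (f : Fin 15 → Fin 15) : Fin 15 → Finset (Fin 15) :=
  fun a => Finset.univ.filter (fun b => f b = f a)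

theorem partOf_isPartition (f : Fin 15 → Fin 15) : IsPartition (partOf f) := by
  refine ⟨fun i => by simp [partOf], fun i j h => ?_⟩
  simp only [partOf, Finset.mem_filter, Finset.mem_univ, true_and] at h ⊢
  rw [h]

/-- The time following `m` in the lasso. -/
def nextTime (m : ℕ) : ℕ := if m = 20 then 13 else m + 1

instance (π π' : Fin 15 → Finset (Fin 15)) (i : Fin 15) :
    Decidable (IsISDeviation (hdgPref redAgents gamePref) π π' i) := by
  unfold IsISDeviation StrictPref hdgPref; infer_instance

theorem all_deviations : ∀ m : Fin 21, IsISDeviation (hdgPref redAgents gamePref)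
    (partOf (labels m)) (partOf (labels (nextTime m))) (moves.getD m (0, 0)).1 := by
  decide +kernel

theorem params_pos : ∀ i, 0 < (params i).1 ∧ 0 < (params i).2.1 := by
  decide +kernel

theorem iterate_lt (k : ℕ) : nextTime^[k] 0 < 21 := by
  induction k with
  | zero => simp
  | succ k ih =>
    beta_reduce
    rw [Function.iterate_succ_apply']
    generalize nextTime^[k] 0 = m at ih
    unfold nextTime
    split_ifs <;> omega

/-- There exists a hedonic diversity game with strict and naturally
single-peaked preferences admitting an infinite sequence of IS deviations
starting from the singleton partition (deviations not required to satisfy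
solitary homogeneity). -/
theorem hdg_strict_natSP_cycle_from_singletons :
    ∃ (n : ℕ) (R : Finset (Fin n)) (rp : Fin n → ℚ → ℚ → Prop),
      (∀ i, WeakOrderOn (rp i) (RatioSet R.card n)) ∧
      (∀ i, StrictPrefsOn (rp i) (RatioSet R.card n)) ∧
      (∀ i, SinglePeakedOn (rp i) (RatioSet R.card n)) ∧
      ∃ seq : ℕ → Fin n → Finset (Fin n),
        seq 0 = (fun a => {a}) ∧
        ∀ k, ISStep (hdgPref R rp) (seq k) (seq (k + 1)) := by
  refine ⟨15, redAgents, gamePref, fun i => utilPref_weak _ _ _ _,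
    fun i => utilPref_strict _ _ _ _,
    fun i => utilPref_sp _ _ _ (params_pos i).1 (params_pos i).2 _,
    fun k => partOf (labels (nextTime^[k] 0)), ?_, fun k => ?_⟩
  · funext a
    ext b
    change b ∈ Finset.univ.filter (fun c : Fin 15 => c = a) ↔ _
    rw [Finset.mem_filter]
    simp
  · refine ⟨partOf_isPartition _, partOf_isPartition _,
      (moves.getD (nextTime^[k] 0) (0, 0)).1, ?_⟩
    beta_reduce
    rw [Function.iterate_succ_apply']
    exact all_deviations ⟨nextTime^[k] 0, iterate_lt k⟩
end

section
/- There exists a constant C > 0 such that for every hedonic diversity game on n agents in which all agents have strict and naturally single-peaked preferences, every sequence of IS deviations starting from the singleton partition in which every deviation satisfies solitary homogeneity has length at most C·n^5; in particular every such maximal sequence terminates in an individually stable partition. -/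
/-- Ratio of own colour, with `s` agents of own colour and `o` of the other one. -/
def rat (s o : ℕ) : ℚ := (s : ℚ) / ((s : ℚ) + (o : ℚ))

theorem rat_lt {s o s' o' : ℕ} (h : 0 < s + o) (h' : 0 < s' + o') :
    rat s o < rat s' o' ↔ s * (s' + o') < s' * (s + o) := by
  unfold rat
  have h1 : (0 : ℚ) < (s : ℚ) + o := by exact_mod_cast h
  have h2 : (0 : ℚ) < (s' : ℚ) + o' := by exact_mod_cast h'
  rw [div_lt_div_iff₀ h1 h2]
  exact_mod_cast Iff.rfl

theorem rat_lt_leaf {a b : ℕ} (h : a < b) : rat a 1 < rat b 1 := by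
  rw [rat_lt (by omega) (by omega)]; nlinarith

theorem rat_le_leaf {a b : ℕ} (h : a ≤ b) : rat a 1 ≤ rat b 1 := by
  rcases h.lt_or_eq with h | h
  · exact (rat_lt_leaf h).le
  · rw [h]

theorem rat_leaf_lt_one {a : ℕ} : rat a 1 < rat 1 0 := by
  rw [rat_lt (by omega) (by omega)]; omega

theorem rat_lt_center {a b : ℕ} (h : a < b) : rat 1 b < rat 1 a := by
  rw [rat_lt (by omega) (by omega)]; omega

/-- A strict single-peaked preference relation on `S`. -/
structure SPref (r : ℚ → ℚ → Prop) (S : Set ℚ) : Prop where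
  tot : ∀ x ∈ S, ∀ y ∈ S, r x y ∨ r y x
  tr : ∀ x ∈ S, ∀ y ∈ S, ∀ z ∈ S, r x y → r y z → r x z
  anti : ∀ x ∈ S, ∀ y ∈ S, r x y → r y x → x = y
  sp : ∀ x ∈ S, ∀ y ∈ S, ∀ z ∈ S, ((x < y ∧ y < z) ∨ (z < y ∧ y < x)) → r x y → r y z

theorem SPref.strict {r : ℚ → ℚ → Prop} {S : Set ℚ} (h : SPref r S) {x y : ℚ}
    (hx : x ∈ S) (hy : y ∈ S) (hne : x ≠ y) (hr : r x y) : ¬ r y x :=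
  fun hback => hne (h.anti x hx y hy hr hback)

/-- The potential value of a ratio. -/
noncomputable def vv (r : ℚ → ℚ → Prop) (S : Set ℚ) (n : ℕ) (x : ℚ) : ℕ :=
  sInf {j : ℕ | 1 ≤ j ∧ (j = n + 1 ∨ ∃ z ∈ S, z ≤ rat j 1 ∧ r z x)}

theorem vv_mem (r : ℚ → ℚ → Prop) (S : Set ℚ) (n : ℕ) (x : ℚ) :
    1 ≤ vv r S n x ∧ (vv r S n x = n + 1 ∨ ∃ z ∈ S, z ≤ rat (vv r S n x) 1 ∧ r z x) := by
  have : vv r S n x ∈ {j : ℕ | 1 ≤ j ∧ (j = n + 1 ∨ ∃ z ∈ S, z ≤ rat j 1 ∧ r z x)} :=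
    Nat.sInf_mem ⟨n + 1, by omega, Or.inl rfl⟩
  exact this

theorem vv_le {r : ℚ → ℚ → Prop} {S : Set ℚ} {n : ℕ} {x : ℚ} {j : ℕ} (h1 : 1 ≤ j)
    (h : j = n + 1 ∨ ∃ z ∈ S, z ≤ rat j 1 ∧ r z x) : vv r S n x ≤ j :=
  Nat.sInf_le ⟨h1, h⟩

theorem vv_le_n {r : ℚ → ℚ → Prop} {S : Set ℚ} {n : ℕ} {x : ℚ} : vv r S n x ≤ n + 1 :=
  vv_le (by omega) (Or.inl rfl)

theorem vv_mono {r : ℚ → ℚ → Prop} {S : Set ℚ} {n : ℕ} (h : SPref r S) {x y : ℚ}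
    (hx : x ∈ S) (hy : y ∈ S) (hr : r y x) : vv r S n x ≤ vv r S n y := by
  obtain ⟨h1, h2⟩ := vv_mem r S n y
  apply vv_le h1
  rcases h2 with h2 | ⟨z, hz, h3, h4⟩
  · exact Or.inl h2
  · exact Or.inr ⟨z, hz, h3, h.tr z hz y hy x hx h4 hr⟩

theorem vv_le_leaf {r : ℚ → ℚ → Prop} {S : Set ℚ} {n : ℕ} (h : SPref r S) {x : ℚ} {k : ℕ}
    (hx : x ∈ S) (hk : 1 ≤ k) (hr : x ≤ rat k 1) : vv r S n x ≤ k :=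
  vv_le hk (Or.inr ⟨x, hx, hr, by rcases h.tot x hx x hx with h | h <;> exact h⟩)

theorem vv_gt {r : ℚ → ℚ → Prop} {S : Set ℚ} {n : ℕ} (h : SPref r S) {y : ℚ} {k : ℕ}
    (hy : y ∈ S) (hk : rat k 1 ∈ S) (hkn : k ≤ n) (hlt : rat k 1 < y)
    (hr : r y (rat k 1)) : k + 1 ≤ vv r S n y := by
  obtain ⟨h1, h2⟩ := vv_mem r S n y
  by_contra hc
  rcases h2 with h2 | ⟨z, hz, h3, h4⟩
  · omega
  · have h5 : z ≤ rat k 1 := h3.trans (rat_le_leaf (by omega))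
    have h6 := h.tr z hz y hy _ hk h4 hr
    rcases h5.lt_or_eq with h5 | h5
    · have h7 := h.sp y hy _ hk z hz (Or.inr ⟨h5, hlt⟩) hr
      exact h5.ne (h.anti z hz _ hk h6 h7)
    · rw [h5] at h4
      exact hlt.ne (h.anti _ hk y hy h4 hr)

section Game

set_option linter.unusedSectionVars false

variable {A : Type} [Fintype A] [DecidableEq A]

/-- Number of agents of the colour of `i` in `X`. -/
def ow (R : Finset A) (i : A) (X : Finset A) : ℕ := (X.filter (fun x => x ∈ R ↔ i ∈ R)).card

/-- Number of agents of the other colour in `X`. -/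
def ot (R : Finset A) (i : A) (X : Finset A) : ℕ := (X.filter (fun x => ¬ (x ∈ R ↔ i ∈ R))).card

/-- Translation between own ratio and red ratio. -/
def ph (R : Finset A) (i : A) (x : ℚ) : ℚ := if i ∈ R then x else 1 - x

/-- Preferences on own ratios. -/
def opr (R : Finset A) (rp : A → ℚ → ℚ → Prop) (i : A) (x y : ℚ) : Prop :=
  rp i (ph R i x) (ph R i y)

/-- Domain of own ratios. -/
def SS (R : Finset A) (i : A) : Set ℚ := {x | ph R i x ∈ RatioSet R.card (Fintype.card A)}

/-- Own ratio. -/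
def orat (R : Finset A) (i : A) (X : Finset A) : ℚ := rat (ow R i X) (ot R i X)

theorem ow_add_ot (R : Finset A) (i : A) (X : Finset A) : ow R i X + ot R i X = X.card := by
  unfold ow ot
  exact Finset.card_filter_add_card_filter_not (s := X) (fun x => x ∈ R ↔ i ∈ R)

theorem ow_pos {R : Finset A} {i : A} {X : Finset A} (h : i ∈ X) : 1 ≤ ow R i X :=
  Finset.card_pos.mpr ⟨i, by simp [h]⟩

theorem ow_red {R : Finset A} {i : A} (X : Finset A) (h : i ∈ R) : ow R i X = (R ∩ X).card := by
  unfold ow; congr 1; ext x; simp [h]; tauto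

theorem ot_blue {R : Finset A} {i : A} (X : Finset A) (h : i ∉ R) : ot R i X = (R ∩ X).card := by
  unfold ot; congr 1; ext x; simp [h]; tauto

theorem redRatio_eq {R : Finset A} {i : A} {X : Finset A} (h : X.Nonempty) :
    redRatio R X = ph R i (orat R i X) := by
  have h1 := ow_add_ot R i X
  have h2 : (X.card : ℚ) ≠ 0 := by
    have := Finset.card_pos.mpr h
    exact_mod_cast this.ne'
  have h1' : (ow R i X : ℚ) + (ot R i X : ℚ) = X.card := by exact_mod_cast h1
  unfold redRatio ph orat rat
  rw [h1']
  split_ifs with hi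
  · rw [ow_red X hi]
  · rw [← ot_blue X hi]
    field_simp
    linarith

theorem mem_SS {R : Finset A} {i : A} {X : Finset A} {s o : ℕ}
    (hs : s ≤ ow R i X) (ho : o ≤ ot R i X) (h : 0 < s + o) : rat s o ∈ SS R i := by
  have h1 := ow_add_ot R i X
  have h3 : X.card ≤ Fintype.card A := Finset.card_le_univ X
  have h4 : (R ∩ X).card ≤ R.card := Finset.card_le_card Finset.inter_subset_left
  have h5 : (s : ℚ) + o ≠ 0 := by exact_mod_cast h.ne'
  unfold SS ph rat
  simp only [Set.mem_ofPred_eq]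
  split_ifs with hi
  · refine ⟨s, s + o, ?_, by omega, by omega, by push_cast; rfl⟩
    rw [ow_red X hi] at hs; omega
  · refine ⟨o, s + o, ?_, by omega, by omega, ?_⟩
    · rw [ot_blue X hi] at ho; omega
    · push_cast; field_simp; ring

theorem orat_mem {R : Finset A} {i : A} {X : Finset A} (h : i ∈ X) : orat R i X ∈ SS R i :=
  mem_SS (X := X) le_rfl le_rfl (by have := ow_pos (R := R) h; omega)

theorem opr_SPref (R : Finset A) (rp : A → ℚ → ℚ → Prop) (i : A)
    (h1 : WeakOrderOn (rp i) (RatioSet R.card (Fintype.card A)))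
    (h2 : StrictPrefsOn (rp i) (RatioSet R.card (Fintype.card A)))
    (h3 : SinglePeakedOn (rp i) (RatioSet R.card (Fintype.card A))) :
    SPref (opr R rp i) (SS R i) := by
  have inj : ∀ x y, ph R i x = ph R i y → x = y := by
    intro x y h; unfold ph at h; split_ifs at h <;> linarith
  refine ⟨fun x hx y hy => h1.1 _ hx _ hy, fun x hx y hy z hz => h1.2 _ hx _ hy _ hz,
    fun x hx y hy a b => inj _ _ (h2 _ hx _ hy a b), ?_⟩
  intro x hx y hy z hz hb hr
  apply h3 _ hx _ hy _ hz
  · unfold ph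
    split_ifs
    · exact hb
    · rcases hb with hb | hb
      · right; constructor <;> linarith
      · left; constructor <;> linarith
  · refine ⟨hr, fun h => ?_⟩
    have := inj _ _ (h2 _ hx _ hy hr h)
    rcases hb with hb | hb <;> linarith

theorem cnt_same {R : Finset A} {i j : A} {X : Finset A} (hs : j ∈ R ↔ i ∈ R) :
    ow R j X = ow R i X ∧ ot R j X = ot R i X := by
  unfold ow ot; simp [hs]

theorem cnt_diff {R : Finset A} {i j : A} {X : Finset A} (hs : ¬ (j ∈ R ↔ i ∈ R)) :
    ow R j X = ot R i X ∧ ot R j X = ow R i X := by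
  unfold ow ot
  constructor <;> congr 1 <;> ext x <;> simp <;> tauto

theorem cnt_erase {R : Finset A} {i : A} {X : Finset A} (hi : i ∈ X) :
    ow R i (X.erase i) + 1 = ow R i X ∧ ot R i (X.erase i) = ot R i X := by
  unfold ow ot
  constructor
  · rw [Finset.filter_erase, Finset.card_erase_add_one]; simp [hi]
  · rw [Finset.filter_erase, Finset.erase_eq_of_notMem]; simp

theorem cnt_erase_same {R : Finset A} {i j : A} {X : Finset A} (hi : i ∈ X) (hj : j ∈ X)
    (hne : j ≠ i) (hs : j ∈ R ↔ i ∈ R) :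
    ow R j X = ow R i X ∧ ot R j X = ot R i X ∧ ow R j (X.erase i) = ow R i X - 1 ∧
    ot R j (X.erase i) = ot R i X ∧ 2 ≤ ow R i X := by
  have h1 := cnt_same (X := X) hs
  have h2 := cnt_same (X := X.erase i) hs
  have h3 := cnt_erase (R := R) hi
  have h4 : 1 ≤ ow R j (X.erase i) := ow_pos (by simp [hj, hne])
  omega

theorem cnt_erase_diff {R : Finset A} {i j : A} {X : Finset A} (hi : i ∈ X) (hj : j ∈ X)
    (hs : ¬ (j ∈ R ↔ i ∈ R)) :
    ow R j X = ot R i X ∧ ot R j X = ow R i X ∧ ow R j (X.erase i) = ot R i X ∧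
    ot R j (X.erase i) = ow R i X - 1 ∧ 1 ≤ ow R i X ∧ 1 ≤ ot R i X := by
  have h1 := cnt_diff (X := X) hs
  have h2 := cnt_diff (X := X.erase i) hs
  have h3 := cnt_erase (R := R) hi
  have h4 : 1 ≤ ow R j X := ow_pos hj
  omega

/-- Invariant of the dynamics. -/
structure GInv (R : Finset A) (rp : A → ℚ → ℚ → Prop) (π : A → Finset A) : Prop where
  I1 : ∀ j, ot R j (π j) = 0 → ow R j (π j) = 1
  I2 : ∀ j, ow R j (π j) ≤ 1 ∨ ot R j (π j) ≤ 1
  I3 : ∀ j j', j' ∈ π j → j' ≠ j → (j' ∈ R ↔ j ∈ R) → ot R j (π j) = 1 →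
    opr R rp j (rat (ow R j (π j)) 1) (rat (ow R j (π j) - 1) 1) ∨
    opr R rp j' (rat (ow R j (π j)) 1) (rat (ow R j (π j) - 1) 1)
  I4 : ∀ j, ow R j (π j) = 1 → 2 ≤ ot R j (π j) →
    opr R rp j (rat 1 (ot R j (π j))) (rat 1 (ot R j (π j) - 1))

/-- Unfolded description of a deviation. -/
structure Dev (R : Finset A) (rp : A → ℚ → ℚ → Prop) (π π' : A → Finset A) (i : A) : Prop where
  iC : i ∈ π i
  iD : i ∈ π' i
  hC : ∀ j ∈ π i, j ≠ i → π' j = (π i).erase i ∧ π j = π i ∧ j ∉ π' i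
  hD : ∀ j ∈ π' i, j ≠ i → π' j = π' i ∧ π j = (π' i).erase i ∧ j ∉ π i
  hO : ∀ j, j ∉ π i → j ∉ π' i → π' j = π j
  imp : opr R rp i (orat R i (π' i)) (orat R i (π i))
  nimp : ¬ opr R rp i (orat R i (π i)) (orat R i (π' i))
  acc : ∀ j ∈ π' i, j ≠ i → opr R rp j (orat R j (π' i)) (orat R j ((π' i).erase i))
  sh : ot R i (π' i) = 0 → ow R i (π' i) = 1

theorem dev_of_step {R : Finset A} {rp : A → ℚ → ℚ → Prop} {π π' : A → Finset A}
    (h : ISStepSH R rp π π') : ∃ i, Dev R rp π π' i := by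
  obtain ⟨hp, hp', i, ⟨hne, her, hst, hacc⟩, hsh⟩ := h
  have iC := hp.1 i
  have iD := hp'.1 i
  have hD : ∀ j ∈ π' i, j ≠ i → π' j = π' i ∧ π j = (π' i).erase i ∧ j ∉ π i := by
    intro j hj hji
    have e1 := hp'.2 j i hj
    have e2 := her j hji
    have e3 : i ∉ π j := by
      intro hi
      have e4 := hp.2 i j hi
      apply hne
      rw [e1, ← e4] at e2
      rw [← Finset.insert_erase iD, e2, Finset.insert_erase iC]
    refine ⟨e1, ?_, ?_⟩
    · rw [← e1, e2, Finset.erase_eq_of_notMem e3]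
    · intro hjC
      rw [hp.2 j i hjC] at e3
      exact e3 iC
  have hnD : ∀ j, j ∉ π' i → π' j = (π j).erase i := by
    intro j hj
    have hji : j ≠ i := by rintro rfl; exact hj iD
    rw [← her j hji, Finset.erase_eq_of_notMem]
    intro hi
    rw [hp'.2 i j hi] at hj
    exact hj (hp'.1 j)
  refine ⟨i, iC, iD, ?_, hD, ?_, ?_, ?_, ?_, ?_⟩
  · intro j hj hji
    have h1 : j ∉ π' i := fun h => (hD j h hji).2.2 hj
    have h2 := hp.2 j i hj
    exact ⟨by rw [hnD j h1, h2], h2, h1⟩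
  · intro j h1 h2
    rw [hnD j h2, Finset.erase_eq_of_notMem]
    intro hi
    rw [hp.2 i j hi] at h1
    exact h1 (hp.1 j)
  · have := hst.1
    unfold hdgPref at this
    rwa [redRatio_eq (i := i) ⟨i, iC⟩, redRatio_eq (i := i) ⟨i, iD⟩] at this
  · have := hst.2
    unfold hdgPref at this
    rwa [redRatio_eq (i := i) ⟨i, iC⟩, redRatio_eq (i := i) ⟨i, iD⟩] at this
  · intro j hj hji
    have := hacc j (by simp [hj, hji])
    unfold hdgPref at this
    obtain ⟨e1, e2, -⟩ := hD j hj hji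
    rwa [e1, e2, redRatio_eq (i := j) ⟨i, iD⟩,
      redRatio_eq (i := j) ⟨j, by simp [hj, hji]⟩] at this
  · intro h0
    have hc := ow_add_ot R i (π' i)
    have : HomogeneousCoalition R (π' i) := by
      unfold ot at h0
      rw [Finset.card_eq_zero, Finset.filter_eq_empty_iff] at h0
      by_cases hi : i ∈ R
      · left; intro x hx; have := h0 hx; tauto
      · right; intro x hx; have := h0 hx; tauto
    have := hsh this
    omega

theorem target_class {R : Finset A} {rp : A → ℚ → ℚ → Prop} {π π' : A → Finset A} {i : A}
    (hP : ∀ j, SPref (opr R rp j) (SS R j)) (hI : GInv R rp π) (hd : Dev R rp π π' i) :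
    (ot R i (π' i) = 0 ∧ ow R i (π' i) = 1) ∨ ot R i (π' i) = 1 := by
  by_cases h0 : ot R i (π' i) = 0
  · exact Or.inl ⟨h0, hd.sh h0⟩
  by_cases h1 : ot R i (π' i) = 1
  · exact Or.inr h1
  exfalso
  have h2 : 1 < ((π' i).filter (fun x => ¬ (x ∈ R ↔ i ∈ R))).card := by
    change 1 < ot R i (π' i); omega
  obtain ⟨j, hj, j', hj', hne⟩ := Finset.one_lt_card.mp h2
  simp only [Finset.mem_filter] at hj hj'
  have hji : j ≠ i := by rintro rfl; tauto
  have hji' : j' ≠ i := by rintro rfl; tauto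
  obtain ⟨e1, e2, -⟩ := hd.hD j hj.1 hji
  have c1 := cnt_erase_diff hd.iD hj.1 hj.2
  have c2 := cnt_erase_diff hd.iD hj'.1 hj'.2
  have i1 := hI.I1 j
  have i2 := hI.I2 j
  have i3 := hI.I3 j j' (by rw [e2]; simp [hj'.1, hji']) hne.symm (by tauto)
  rw [e2] at i1 i2 i3
  obtain ⟨b, hb⟩ : ∃ b, ot R i (π' i) = b + 2 := ⟨ot R i (π' i) - 2, by omega⟩
  have ha : ow R i (π' i) = 2 := by omega
  have key : ∀ l, l ∈ π' i ∧ ¬ (l ∈ R ↔ i ∈ R) → l ≠ i →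
      ¬ opr R rp l (rat (b + 2) 1) (rat (b + 1) 1) := by
    intro l hl hli hr
    have ac := hd.acc l hl.1 hli
    have c := cnt_erase_diff hd.iD hl.1 hl.2
    unfold orat at ac
    have t1 : ow R l (π' i) = b + 2 := by omega
    have t2 : ot R l (π' i) = 2 := by omega
    have t3 : ow R l ((π' i).erase i) = b + 2 := by omega
    have t4 : ot R l ((π' i).erase i) = 1 := by omega
    rw [t1, t2, t3, t4] at ac
    have m1 : rat (b + 2) 1 ∈ SS R l := mem_SS (X := π' i) (by omega) (by omega) (by omega)
    have m2 : rat (b + 1) 1 ∈ SS R l := mem_SS (X := π' i) (by omega) (by omega) (by omega)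
    have m3 : rat (b + 2) 2 ∈ SS R l := mem_SS (X := π' i) (by omega) (by omega) (by omega)
    have l1 : rat (b + 1) 1 < rat (b + 2) 1 := rat_lt_leaf (by omega)
    have l2 : ¬ rat (b + 1) 1 < rat (b + 2) 2 := by
      rw [rat_lt (by omega) (by omega)]; nlinarith
    rcases (not_lt.mp l2).lt_or_eq with l3 | l3
    · have := (hP l).sp _ m1 _ m2 _ m3 (Or.inr ⟨l3, l1⟩) hr
      have := (hP l).tr _ m2 _ m3 _ m1 this ac
      exact l1.ne ((hP l).anti _ m2 _ m1 this hr)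
    · rw [l3] at ac
      exact l1.ne ((hP l).anti _ m2 _ m1 ac hr)
  have t3 : ow R j ((π' i).erase i) = b + 2 := by omega
  rw [t3] at i3
  rcases i3 (by omega) with h | h
  · exact key j hj hji h
  · exact key j' hj' hji' h

theorem source_class {R : Finset A} {rp : A → ℚ → ℚ → Prop} {π π' : A → Finset A} {i : A}
    (hP : ∀ j, SPref (opr R rp j) (SS R j)) (hI : GInv R rp π) (hd : Dev R rp π π' i) :
    (ot R i (π i) = 0 ∧ ow R i (π i) = 1) ∨ ot R i (π i) = 1 := by
  by_cases h0 : ot R i (π i) = 0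
  · exact Or.inl ⟨h0, hI.I1 i h0⟩
  by_cases h1 : ot R i (π i) = 1
  · exact Or.inr h1
  exfalso
  have hk : ow R i (π i) = 1 := by
    have := hI.I2 i; have := ow_pos (R := R) hd.iC; omega
  have i4 := hI.I4 i hk (by omega)
  obtain ⟨o, ho⟩ : ∃ o, ot R i (π i) = o + 2 := ⟨ot R i (π i) - 2, by omega⟩
  have n1 := hd.nimp
  have m3 := orat_mem (R := R) hd.iD
  have m1 : rat 1 (o + 2) ∈ SS R i := mem_SS (X := π i) (by omega) (by omega) (by omega)
  have m2 : rat 1 (o + 1) ∈ SS R i := mem_SS (X := π i) (by omega) (by omega) (by omega)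
  have hcur : orat R i (π i) = rat 1 (o + 2) := by unfold orat; rw [hk, ho]
  rw [hcur] at n1
  rw [ho] at i4
  have l1 : rat 1 (o + 2) < rat 1 (o + 1) := rat_lt_center (by omega)
  have ha := ow_pos (R := R) hd.iD
  have l2 : ¬ orat R i (π' i) < rat 1 (o + 1) := by
    unfold orat
    rw [rat_lt (by omega) (by omega)]
    rcases target_class hP hI hd with h | h
    · rw [h.1, h.2]; omega
    · rw [h]; nlinarith
  rcases (not_lt.mp l2).lt_or_eq with l3 | l3
  · exact n1 ((hP i).tr _ m1 _ m2 _ m3 i4 ((hP i).sp _ m1 _ m2 _ m3 (Or.inl ⟨l1, l3⟩) i4))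
  · rw [← l3] at n1; exact n1 i4

/-- Acceptance by the leaves of the joined coalition. -/
theorem acc_leaf {R : Finset A} {rp : A → ℚ → ℚ → Prop} {π π' : A → Finset A} {i j : A}
    (hd : Dev R rp π π' i) (hb : ot R i (π' i) = 1) (hj : j ∈ π' i) (hji : j ≠ i)
    (hs : j ∈ R ↔ i ∈ R) :
    opr R rp j (rat (ow R i (π' i)) 1) (rat (ow R i (π' i) - 1) 1) := by
  have ac := hd.acc j hj hji
  obtain ⟨c1, c2, c3, c4, -⟩ := cnt_erase_same hd.iD hj hji hs
  unfold orat at ac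
  rwa [c1, c2, c3, c4, hb] at ac

theorem inv_step {R : Finset A} {rp : A → ℚ → ℚ → Prop} {π π' : A → Finset A} {i : A}
    (hP : ∀ j, SPref (opr R rp j) (SS R j)) (hI : GInv R rp π) (hd : Dev R rp π π' i) :
    GInv R rp π' := by
  have ht := target_class hP hI hd
  have hs := source_class hP hI hd
  have ha := ow_pos (R := R) hd.iD
  have hk := ow_pos (R := R) hd.iC
  refine ⟨?_, ?_, ?_, ?_⟩
  · intro j
    by_cases hji : j = i
    · subst hji; omega
    by_cases hjD : j ∈ π' i
    · obtain ⟨e1, -, -⟩ := hd.hD j hjD hji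
      rw [e1]
      by_cases hc : j ∈ R ↔ i ∈ R
      · have := cnt_erase_same hd.iD hjD hji hc; omega
      · have := cnt_erase_diff hd.iD hjD hc; omega
    by_cases hjC : j ∈ π i
    · obtain ⟨e1, -, -⟩ := hd.hC j hjC hji
      rw [e1]
      by_cases hc : j ∈ R ↔ i ∈ R
      · have := cnt_erase_same hd.iC hjC hji hc; omega
      · have := cnt_erase_diff hd.iC hjC hc; omega
    rw [hd.hO j hjC hjD]; exact hI.I1 j
  · intro j
    by_cases hji : j = i
    · subst hji; omega
    by_cases hjD : j ∈ π' i
    · obtain ⟨e1, -, -⟩ := hd.hD j hjD hji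
      rw [e1]
      by_cases hc : j ∈ R ↔ i ∈ R
      · have := cnt_erase_same hd.iD hjD hji hc; omega
      · have := cnt_erase_diff hd.iD hjD hc; omega
    by_cases hjC : j ∈ π i
    · obtain ⟨e1, -, -⟩ := hd.hC j hjC hji
      rw [e1]
      by_cases hc : j ∈ R ↔ i ∈ R
      · have := cnt_erase_same hd.iC hjC hji hc; omega
      · have := cnt_erase_diff hd.iC hjC hc; omega
    rw [hd.hO j hjC hjD]; exact hI.I2 j
  · intro j j' hj' hne hc ho
    by_cases hjD : j ∈ π' i
    · have e1 : π' j = π' i := by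
        by_cases hji : j = i
        · rw [hji]
        · exact (hd.hD j hjD hji).1
      rw [e1] at hj' ho ⊢
      by_cases hci : j ∈ R ↔ i ∈ R
      · have cs := cnt_same (X := π' i) hci
        rw [cs.1]
        have hb : ot R i (π' i) = 1 := by omega
        by_cases hji : j = i
        · right
          exact acc_leaf hd hb hj' (by rw [← hji]; exact hne) (by tauto)
        · left
          exact acc_leaf hd hb hjD hji hci
      · have cs := cnt_diff (X := π' i) hci
        exfalso
        have : 1 < ow R j (π' i) := by
          apply Finset.one_lt_card.mpr
          exact ⟨j, by simp [hjD], j', by simp [hj', hc], hne.symm⟩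
        omega
    have hji : j ≠ i := by rintro rfl; exact hjD hd.iD
    by_cases hjC : j ∈ π i
    · obtain ⟨e1, e2, -⟩ := hd.hC j hjC hji
      rw [e1] at hj' ho ⊢
      have hj'i : j' ≠ i := Finset.ne_of_mem_erase hj'
      have hj'C : j' ∈ π i := Finset.mem_of_mem_erase hj'
      have h2 : 1 < ow R j ((π i).erase i) := by
        apply Finset.one_lt_card.mpr
        exact ⟨j, by simp [hjC, hji], j', by simp [hj'C, hj'i, hc], hne.symm⟩
      by_cases hci : j ∈ R ↔ i ∈ R
      · have c1 := cnt_erase_same hd.iC hjC hji hci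
        have hci' : j' ∈ R ↔ i ∈ R := by tauto
        have c2 := cnt_erase_same hd.iC hj'C hj'i hci'
        have i3 := hI.I3 j j' (by rw [e2]; exact hj'C) hne hc (by rw [e2]; omega)
        rw [e2] at i3
        obtain ⟨k, hk'⟩ : ∃ k, ow R i (π i) = k + 3 := ⟨ow R i (π i) - 3, by omega⟩
        have t1 : ow R j (π i) = k + 3 := by omega
        have t2 : ow R j ((π i).erase i) = k + 2 := by omega
        rw [t1] at i3
        rw [t2]
        have key : ∀ l, l ∈ π i → l ≠ i → (l ∈ R ↔ i ∈ R) →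
            opr R rp l (rat (k + 3) 1) (rat (k + 2) 1) →
            opr R rp l (rat (k + 2) 1) (rat (k + 1) 1) := by
          intro l hl hli hlc hr
          have c := cnt_erase_same hd.iC hl hli hlc
          have m1 : rat (k + 3) 1 ∈ SS R l := mem_SS (X := π i) (by omega) (by omega) (by omega)
          have m2 : rat (k + 2) 1 ∈ SS R l := mem_SS (X := π i) (by omega) (by omega) (by omega)
          have m3 : rat (k + 1) 1 ∈ SS R l := mem_SS (X := π i) (by omega) (by omega) (by omega)
          exact (hP l).sp _ m1 _ m2 _ m3
            (Or.inr ⟨rat_lt_leaf (by omega), rat_lt_leaf (by omega)⟩) hr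
        exact i3.imp (key j hjC hji hci) (key j' hj'C hj'i hci')
      · have := cnt_erase_diff hd.iC hjC hci; omega
    rw [hd.hO j hjC hjD] at hj' ho ⊢
    exact hI.I3 j j' hj' hne hc ho
  · intro j h1 h2
    by_cases hji : j = i
    · subst hji; omega
    by_cases hjD : j ∈ π' i
    · obtain ⟨e1, -, -⟩ := hd.hD j hjD hji
      rw [e1] at h1 h2 ⊢
      by_cases hc : j ∈ R ↔ i ∈ R
      · have := cnt_erase_same hd.iD hjD hji hc; omega
      · have c := cnt_erase_diff hd.iD hjD hc
        have ac := hd.acc j hjD hji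
        unfold orat at ac
        rw [h1] at ac
        have t1 : ow R j ((π' i).erase i) = 1 := by omega
        have t2 : ot R j ((π' i).erase i) = ot R j (π' i) - 1 := by omega
        rwa [t1, t2] at ac
    by_cases hjC : j ∈ π i
    · obtain ⟨e1, e2, -⟩ := hd.hC j hjC hji
      rw [e1] at h1 h2 ⊢
      by_cases hc : j ∈ R ↔ i ∈ R
      · have := cnt_erase_same hd.iC hjC hji hc; omega
      · have c := cnt_erase_diff hd.iC hjC hc
        have i4 := hI.I4 j
        rw [e2] at i4
        have i4' := i4 (by omega) (by omega)
        obtain ⟨k, hk'⟩ : ∃ k, ow R i (π i) = k + 3 := ⟨ow R i (π i) - 3, by omega⟩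
        have t1 : ot R j (π i) = k + 3 := by omega
        have t2 : ot R j ((π i).erase i) = k + 2 := by omega
        rw [t1] at i4'
        rw [t2]
        have m1 : rat 1 (k + 3) ∈ SS R j := mem_SS (X := π i) (by omega) (by omega) (by omega)
        have m2 : rat 1 (k + 2) ∈ SS R j := mem_SS (X := π i) (by omega) (by omega) (by omega)
        have m3 : rat 1 (k + 1) ∈ SS R j := mem_SS (X := π i) (by omega) (by omega) (by omega)
        exact (hP j).sp _ m1 _ m2 _ m3
          (Or.inl ⟨rat_lt_center (by omega), rat_lt_center (by omega)⟩) i4'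
    rw [hd.hO j hjC hjD] at h1 h2 ⊢; exact hI.I4 j h1 h2

/-- Value of agent `j` in coalition `X`. -/
noncomputable def va (R : Finset A) (rp : A → ℚ → ℚ → Prop) (j : A) (X : Finset A) : ℕ :=
  vv (opr R rp j) (SS R j) (Fintype.card A) (orat R j X)

/-- Primary potential of agent `j` in coalition `X`. -/
noncomputable def pp (R : Finset A) (rp : A → ℚ → ℚ → Prop) (j : A) (X : Finset A) : ℤ :=
  2 * (va R rp j X : ℤ) - (ow R j X : ℤ)

/-- Secondary potential of agent `j` in coalition `X`. -/
def qq (R : Finset A) (j : A) (X : Finset A) : ℤ :=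
  if ot R j X = 0 then 2 * (Fintype.card A : ℤ) + 2 else (ow R j X : ℤ)

/-- Indicator of membership with the colour of `i`. -/
def ind (R : Finset A) (i : A) (X : Finset A) (j : A) : ℤ :=
  if j ∈ X ∧ (j ∈ R ↔ i ∈ R) then 1 else 0

theorem sum_ind (R : Finset A) (i : A) (X : Finset A) : ∑ j, ind R i X j = (ow R i X : ℤ) := by
  unfold ind ow
  rw [Finset.sum_boole]
  congr 2
  ext x; simp

theorem ow_le (R : Finset A) (i : A) (X : Finset A) : ow R i X ≤ Fintype.card A :=
  Finset.card_le_univ _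

theorem pp_step {R : Finset A} {rp : A → ℚ → ℚ → Prop} {π π' : A → Finset A} {i : A}
    (hP : ∀ j, SPref (opr R rp j) (SS R j)) (hI : GInv R rp π) (hd : Dev R rp π π' i) (j : A) :
    pp R rp j (π j) + (ind R i (π' i) j - ind R i (π i) j + (if j = i then
      2 * (va R rp i (π' i) : ℤ) - 2 * (va R rp i (π i) : ℤ)
        - (ow R i (π' i) : ℤ) + (ow R i (π i) : ℤ) else 0)) ≤ pp R rp j (π' j) := by
  have ht := target_class hP hI hd
  have hs := source_class hP hI hd
  by_cases hji : j = i
  · subst hji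
    have h1 : ind R j (π' j) j = 1 := by simp [ind, hd.iD]
    have h2 : ind R j (π j) j = 1 := by simp [ind, hd.iC]
    rw [h1, h2]; simp only [pp, if_true]; omega
  rw [if_neg hji]
  by_cases hjD : j ∈ π' i
  · obtain ⟨e1, e2, e3⟩ := hd.hD j hjD hji
    rw [e1, e2]
    have h2 : ind R i (π i) j = 0 := by simp [ind, e3]
    have ac := hd.acc j hjD hji
    by_cases hc : j ∈ R ↔ i ∈ R
    · have h1 : ind R i (π' i) j = 1 := by simp [ind, hjD, hc]
      have c := cnt_erase_same hd.iD hjD hji hc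
      have hb : ot R i (π' i) = 1 := by omega
      have ac' := acc_leaf hd hb hjD hji hc
      obtain ⟨a, ha⟩ : ∃ a, ow R i (π' i) = a + 2 := ⟨ow R i (π' i) - 2, by omega⟩
      have t1 : orat R j (π' i) = rat (a + 2) 1 := by
        unfold orat; rw [c.1, c.2.1, hb, ha]
      have t2 : orat R j ((π' i).erase i) = rat (a + 1) 1 := by
        unfold orat; rw [c.2.2.1, c.2.2.2.1, hb, ha]; rfl
      have m1 : rat (a + 2) 1 ∈ SS R j := mem_SS (X := π' i) (by omega) (by omega) (by omega)
      have m2 : rat (a + 1) 1 ∈ SS R j := mem_SS (X := π' i) (by omega) (by omega) (by omega)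
      rw [ha] at ac'
      have v1 : va R rp j (π' i) ≥ a + 1 + 1 := by
        unfold va; rw [t1]
        exact vv_gt (hP j) m1 m2 (by have := ow_le R i (π' i); omega)
          (rat_lt_leaf (by omega)) ac'
      have v2 : va R rp j ((π' i).erase i) ≤ a + 1 := by
        unfold va; rw [t2]
        exact vv_le_leaf (hP j) m2 (by omega) le_rfl
      unfold pp; omega
    · have h1 : ind R i (π' i) j = 0 := by simp [ind, hc]
      have c := cnt_erase_diff hd.iD hjD hc
      have v : va R rp j ((π' i).erase i) ≤ va R rp j (π' i) :=
        vv_mono (hP j) (orat_mem (by simp [hjD, hji])) (orat_mem hjD) ac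
      unfold pp; omega
  have h1 : ind R i (π' i) j = 0 := by simp [ind, hjD]
  by_cases hjC : j ∈ π i
  · obtain ⟨e1, e2, e3⟩ := hd.hC j hjC hji
    rw [e1, e2]
    by_cases hc : j ∈ R ↔ i ∈ R
    · have h2 : ind R i (π i) j = 1 := by simp [ind, hjC, hc]
      have c := cnt_erase_same hd.iC hjC hji hc
      have hb : ot R i (π i) = 1 := by omega
      obtain ⟨a, ha⟩ : ∃ a, ow R i (π i) = a + 2 := ⟨ow R i (π i) - 2, by omega⟩
      have t1 : orat R j (π i) = rat (a + 2) 1 := by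
        unfold orat; rw [c.1, c.2.1, hb, ha]
      have t2 : orat R j ((π i).erase i) = rat (a + 1) 1 := by
        unfold orat; rw [c.2.2.1, c.2.2.2.1, hb, ha]; rfl
      have m1 : rat (a + 2) 1 ∈ SS R j := mem_SS (X := π i) (by omega) (by omega) (by omega)
      have m2 : rat (a + 1) 1 ∈ SS R j := mem_SS (X := π i) (by omega) (by omega) (by omega)
      have m3 : rat a 1 ∈ SS R j := mem_SS (X := π i) (by omega) (by omega) (by omega)
      have v : va R rp j (π i) ≤ va R rp j ((π i).erase i) + 1 := by
        unfold va; rw [t1, t2]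
        rcases (hP j).tot _ m1 _ m2 with hr | hr
        · have v2 : vv (opr R rp j) (SS R j) (Fintype.card A) (rat (a + 2) 1) ≤ a + 2 :=
            vv_le_leaf (hP j) m1 (by omega) le_rfl
          have hr' := (hP j).sp _ m1 _ m2 _ m3
            (Or.inr ⟨rat_lt_leaf (by omega), rat_lt_leaf (by omega)⟩) hr
          have v3 := vv_gt (n := Fintype.card A) (hP j) m2 m3
            (by have := ow_le R i (π i); omega) (rat_lt_leaf (by omega)) hr'
          omega
        · have := vv_mono (n := Fintype.card A) (hP j) m1 m2 hr
          omega
      unfold pp; omega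
    · have h2 : ind R i (π i) j = 0 := by simp [ind, hc]
      have c := cnt_erase_diff hd.iC hjC hc
      have v1 : va R rp j (π i) ≤ 1 := by
        apply vv_le_leaf (hP j) (orat_mem hjC) le_rfl
        unfold orat
        rw [← not_lt, rat_lt (by omega) (by omega)]
        have : ow R j (π i) = 1 := by omega
        rw [this]; omega
      have v2 : 1 ≤ va R rp j ((π i).erase i) := (vv_mem _ _ _ _).1
      unfold pp; omega
  have h2 : ind R i (π i) j = 0 := by simp [ind, hjC]
  rw [hd.hO j hjC hjD, h1, h2]; simp

/-- If the value of the deviator does not change, then it moves to a smaller star. -/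
theorem dev_eq {R : Finset A} {rp : A → ℚ → ℚ → Prop} {π π' : A → Finset A} {i : A}
    (hP : ∀ j, SPref (opr R rp j) (SS R j)) (hI : GInv R rp π) (hd : Dev R rp π π' i) :
    va R rp i (π i) + 1 ≤ va R rp i (π' i) ∨ (va R rp i (π i) = va R rp i (π' i) ∧
      ot R i (π' i) = 1 ∧ ((ot R i (π i) = 0 ∧ ow R i (π i) = 1) ∨
        (ot R i (π i) = 1 ∧ ow R i (π' i) < ow R i (π i)))) := by
  have mC := orat_mem (R := R) hd.iC
  have mD := orat_mem (R := R) hd.iD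
  have mono : va R rp i (π i) ≤ va R rp i (π' i) := vv_mono (hP i) mC mD hd.imp
  by_cases hv : va R rp i (π i) + 1 ≤ va R rp i (π' i)
  · exact Or.inl hv
  right
  refine ⟨by omega, ?_⟩
  have ht := target_class hP hI hd
  have hs := source_class hP hI hd
  have hne : orat R i (π i) ≠ orat R i (π' i) := by
    intro h
    have := hd.imp
    have := hd.nimp
    rw [h] at this
    simp_all
  rcases hs with hs | hs
  · rcases ht with ht | ht
    · exfalso; apply hne; unfold orat; rw [hs.1, hs.2, ht.1, ht.2]
    · exact ⟨ht, Or.inl hs⟩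
  · have hC : orat R i (π i) = rat (ow R i (π i)) 1 := by unfold orat; rw [hs]
    have hk := ow_pos (R := R) hd.iC
    have imp := hd.imp
    have hle : ¬ rat (ow R i (π i)) 1 < orat R i (π' i) := by
      intro hlt
      rw [hC] at imp mC
      have v1 : va R rp i (π i) ≤ ow R i (π i) := by
        unfold va; rw [hC]; exact vv_le_leaf (hP i) mC hk le_rfl
      have v2 : ow R i (π i) + 1 ≤ va R rp i (π' i) :=
        vv_gt (hP i) mD mC (ow_le _ _ _) hlt imp
      omega
    rcases ht with ht | ht
    · exfalso; apply hle; unfold orat; rw [ht.1, ht.2]; exact rat_leaf_lt_one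
    · have hD : orat R i (π' i) = rat (ow R i (π' i)) 1 := by unfold orat; rw [ht]
      refine ⟨ht, Or.inr ⟨hs, ?_⟩⟩
      by_contra hcon
      rw [hC, hD] at hne
      rw [hD] at hle
      rcases (not_lt.mp hcon).lt_or_eq with h | h
      · exact hle (rat_lt_leaf h)
      · rw [h] at hne; exact hne rfl

theorem qq_step {R : Finset A} {rp : A → ℚ → ℚ → Prop} {π π' : A → Finset A} {i : A}
    (hd : Dev R rp π π' i) (hb : ot R i (π' i) = 1)
    (hs : (ot R i (π i) = 0 ∧ ow R i (π i) = 1) ∨ (ot R i (π i) = 1 ∧ 2 ≤ ow R i (π i))) (j : A) :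
    qq R j (π' j) ≤ qq R j (π j) + (ind R i (π' i) j - ind R i (π i) j +
      (if j = i then qq R i (π' i) - qq R i (π i) else 0)) := by
  have hn : ∀ X, (ow R j X : ℤ) ≤ Fintype.card A := fun X => by exact_mod_cast ow_le R j X
  by_cases hji : j = i
  · subst hji
    have h1 : ind R j (π' j) j = 1 := by simp [ind, hd.iD]
    have h2 : ind R j (π j) j = 1 := by simp [ind, hd.iC]
    rw [h1, h2]; simp only [if_true]; omega
  rw [if_neg hji]
  by_cases hjD : j ∈ π' i
  · obtain ⟨e1, e2, e3⟩ := hd.hD j hjD hji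
    rw [e1, e2]
    have h2 : ind R i (π i) j = 0 := by simp [ind, e3]
    by_cases hc : j ∈ R ↔ i ∈ R
    · have h1 : ind R i (π' i) j = 1 := by simp [ind, hjD, hc]
      have c := cnt_erase_same hd.iD hjD hji hc
      unfold qq; rw [if_neg (by omega), if_neg (by omega)]; omega
    · have h1 : ind R i (π' i) j = 0 := by simp [ind, hc]
      have c := cnt_erase_diff hd.iD hjD hc
      have := hn (π' i)
      unfold qq; rw [if_neg (by omega)]; split_ifs <;> omega
  have h1 : ind R i (π' i) j = 0 := by simp [ind, hjD]
  by_cases hjC : j ∈ π i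
  · obtain ⟨e1, e2, e3⟩ := hd.hC j hjC hji
    rw [e1, e2]
    by_cases hc : j ∈ R ↔ i ∈ R
    · have h2 : ind R i (π i) j = 1 := by simp [ind, hjC, hc]
      have c := cnt_erase_same hd.iC hjC hji hc
      unfold qq; rw [if_neg (by omega), if_neg (by omega)]; omega
    · have h2 : ind R i (π i) j = 0 := by simp [ind, hc]
      have c := cnt_erase_diff hd.iC hjC hc
      unfold qq; rw [if_neg (by omega), if_neg (by omega)]; omega
  have h2 : ind R i (π i) j = 0 := by simp [ind, hjC]
  rw [hd.hO j hjC hjD, h1, h2]; simp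

/-- Total primary potential. -/
noncomputable def PP (R : Finset A) (rp : A → ℚ → ℚ → Prop) (π : A → Finset A) : ℤ :=
  ∑ j, pp R rp j (π j)

/-- Total secondary potential. -/
def QQ (R : Finset A) (π : A → Finset A) : ℤ := ∑ j, qq R j (π j)

theorem PQ_step {R : Finset A} {rp : A → ℚ → ℚ → Prop} {π π' : A → Finset A} {i : A}
    (hP : ∀ j, SPref (opr R rp j) (SS R j)) (hI : GInv R rp π) (hd : Dev R rp π π' i) :
    PP R rp π + 1 ≤ PP R rp π' ∨ (PP R rp π ≤ PP R rp π' ∧ QQ R π' + 1 ≤ QQ R π) := by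
  have hp : PP R rp π + (2 * (va R rp i (π' i) : ℤ) - 2 * (va R rp i (π i) : ℤ)) ≤
      PP R rp π' := by
    have := Finset.sum_le_sum (fun j (_ : j ∈ Finset.univ) => pp_step hP hI hd j)
    rw [Finset.sum_add_distrib, Finset.sum_add_distrib, Finset.sum_sub_distrib, sum_ind, sum_ind,
      Finset.sum_ite_eq' Finset.univ i, if_pos (Finset.mem_univ i)] at this
    unfold PP; linarith
  rcases dev_eq hP hI hd with h | ⟨h, hb, hs⟩
  · left; omega
  · right
    refine ⟨by omega, ?_⟩
    have ha := ow_pos (R := R) hd.iD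
    have hn := ow_le R i (π' i)
    have := Finset.sum_le_sum (fun j (_ : j ∈ Finset.univ) => qq_step hd hb
      (by omega) j)
    rw [Finset.sum_add_distrib, Finset.sum_add_distrib, Finset.sum_sub_distrib, sum_ind, sum_ind,
      Finset.sum_ite_eq' Finset.univ i, if_pos (Finset.mem_univ i)] at this
    have q1 : qq R i (π' i) = ow R i (π' i) := by unfold qq; rw [if_neg (by omega)]
    rw [q1] at this
    unfold QQ
    rcases hs with hs | hs
    · have q2 : qq R i (π i) = 2 * (Fintype.card A : ℤ) + 2 := by unfold qq; rw [if_pos hs.1]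
      rw [q2] at this
      omega
    · have q2 : qq R i (π i) = ow R i (π i) := by unfold qq; rw [if_neg (by omega)]
      rw [q2] at this
      omega

theorem PP_bound {R : Finset A} {rp : A → ℚ → ℚ → Prop} (π : A → Finset A) :
    -((Fintype.card A : ℤ) * Fintype.card A) ≤ PP R rp π ∧
    PP R rp π ≤ Fintype.card A * (2 * (Fintype.card A + 1)) := by
  have h : ∀ j ∈ (Finset.univ : Finset A), -(Fintype.card A : ℤ) ≤ pp R rp j (π j) ∧
      pp R rp j (π j) ≤ 2 * ((Fintype.card A : ℤ) + 1) := by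
    intro j _
    have h1 : va R rp j (π j) ≤ Fintype.card A + 1 := vv_le_n
    have h2 := ow_le R j (π j)
    unfold pp; omega
  have h1 := Finset.card_nsmul_le_sum _ _ _ (fun j hj => (h j hj).1)
  have h2 := Finset.sum_le_card_nsmul _ _ _ (fun j hj => (h j hj).2)
  simp only [Finset.card_univ, nsmul_eq_mul] at h1 h2
  unfold PP
  constructor <;> linarith

theorem QQ_bound {R : Finset A} (π : A → Finset A) :
    0 ≤ QQ R π ∧ QQ R π ≤ Fintype.card A * (2 * (Fintype.card A + 1)) := by
  have h : ∀ j ∈ (Finset.univ : Finset A), 0 ≤ qq R j (π j) ∧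
      qq R j (π j) ≤ 2 * ((Fintype.card A : ℤ) + 1) := by
    intro j _
    have h2 := ow_le R j (π j)
    unfold qq; split_ifs <;> omega
  have h1 := Finset.sum_nonneg (fun j hj => (h j hj).1)
  have h2 := Finset.sum_le_card_nsmul _ _ _ (fun j hj => (h j hj).2)
  simp only [Finset.card_univ, nsmul_eq_mul] at h1 h2
  unfold QQ
  constructor <;> linarith

theorem inv_start (R : Finset A) (rp : A → ℚ → ℚ → Prop) : GInv R rp (fun a => {a}) := by
  have h1 : ∀ j, ow R j {j} = 1 := by intro j; simp [ow, Finset.filter_singleton]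
  have h2 : ∀ j, ot R j {j} = 0 := by intro j; simp [ot, Finset.filter_singleton]
  refine ⟨fun j _ => h1 j, fun j => Or.inl (h1 j).le, ?_, ?_⟩
  · intro j j' _ _ _ h; rw [h2] at h; omega
  · intro j _ h; rw [h2] at h; omega

theorem main_bound {R : Finset A} {rp : A → ℚ → ℚ → Prop}
    (hP : ∀ j, SPref (opr R rp j) (SS R j)) (m : ℕ) (seq : ℕ → A → Finset A)
    (h0 : seq 0 = (fun a => {a})) (hst : ∀ k < m, ISStepSH R rp (seq k) (seq (k + 1))) :
    m ≤ 100 * Fintype.card A ^ 5 := by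
  rcases Nat.eq_zero_or_pos m with rfl | hm
  · omega
  have hn : 1 ≤ Fintype.card A := by
    obtain ⟨-, -, i, -⟩ := hst 0 hm
    exact Fintype.card_pos_iff.mpr ⟨i⟩
  have hn' : (1 : ℤ) ≤ Fintype.card A := by exact_mod_cast hn
  obtain ⟨n, hndef⟩ : ∃ n : ℤ, n = Fintype.card A := ⟨_, rfl⟩
  obtain ⟨M, hM⟩ : ∃ M : ℤ, M = n * (2 * (n + 1)) := ⟨_, rfl⟩
  have main : ∀ k ≤ m, GInv R rp (seq k) ∧
      (k : ℤ) + ((M + 1) * PP R rp (seq 0) - QQ R (seq 0)) ≤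
        (M + 1) * PP R rp (seq k) - QQ R (seq k) := by
    intro k
    induction k with
    | zero => intro _; rw [h0]; exact ⟨inv_start R rp, by simp⟩
    | succ k ih =>
      intro hk
      obtain ⟨hI, hle⟩ := ih (by omega)
      obtain ⟨i, hd⟩ := dev_of_step (hst k (by omega))
      refine ⟨inv_step hP hI hd, ?_⟩
      have b1 := QQ_bound (R := R) (seq k)
      have b2 := QQ_bound (R := R) (seq (k + 1))
      rw [← hndef, ← hM] at b1 b2
      have hM0 : 0 ≤ M := by linarith [b1.1, b1.2]
      push_cast
      rcases PQ_step hP hI hd with h | ⟨h, h'⟩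
      · nlinarith [mul_le_mul_of_nonneg_left h (by linarith : (0 : ℤ) ≤ M + 1)]
      · nlinarith [mul_le_mul_of_nonneg_left h (by linarith : (0 : ℤ) ≤ M + 1)]
  have hfin := (main m le_rfl).2
  have p1 := (PP_bound (R := R) (rp := rp) (seq 0)).1
  have p2 := (PP_bound (R := R) (rp := rp) (seq m)).2
  have q1 := (QQ_bound (R := R) (seq 0)).2
  have q2 := (QQ_bound (R := R) (seq m)).1
  rw [← hndef] at p1 p2 q1 hn'
  rw [← hM] at p2 q1
  have hn2 : n ≤ n ^ 2 := by nlinarith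
  have hM4 : M ≤ 4 * n ^ 2 := by nlinarith
  have hM0 : 0 ≤ M := by rw [hM]; positivity
  have hd : PP R rp (seq m) - PP R rp (seq 0) ≤ 5 * n ^ 2 := by nlinarith
  have h1 : (M + 1) * (PP R rp (seq m) - PP R rp (seq 0)) ≤ (M + 1) * (5 * n ^ 2) :=
    mul_le_mul_of_nonneg_left hd (by linarith)
  have h2 : (M + 1) * (5 * n ^ 2) ≤ (5 * n ^ 2) * (5 * n ^ 2) :=
    mul_le_mul_of_nonneg_right (by nlinarith) (by positivity)
  have h3 : (m : ℤ) ≤ 25 * n ^ 4 + 4 * n ^ 2 := by nlinarith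
  have h4 : n ^ 4 ≤ n ^ 5 := pow_le_pow_right₀ hn' (by norm_num)
  have h5 : n ^ 2 ≤ n ^ 5 := pow_le_pow_right₀ hn' (by norm_num)
  have h6 : (m : ℤ) ≤ 100 * n ^ 5 := by
    have : 0 ≤ n ^ 5 := by positivity
    linarith
  rw [hndef] at h6
  exact_mod_cast h6

end Game

/-- There is a constant `C > 0` such that in every hedonic diversity game on `n`
agents with strict and naturally single-peaked preferences, every sequence of IS
deviations starting from the singleton partition in which all deviations satisfy
solitary homogeneity has length at most `C * n^5`. -/
theorem hdg_SH_converges_in_n5 :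
    ∃ C : ℕ, 0 < C ∧
      ∀ (A : Type) [Fintype A] [DecidableEq A]
        (R : Finset A) (rp : A → ℚ → ℚ → Prop),
        (∀ i, WeakOrderOn (rp i) (RatioSet R.card (Fintype.card A))) →
        (∀ i, StrictPrefsOn (rp i) (RatioSet R.card (Fintype.card A))) →
        (∀ i, SinglePeakedOn (rp i) (RatioSet R.card (Fintype.card A))) →
        ∀ (m : ℕ) (seq : ℕ → A → Finset A),
          seq 0 = (fun a => {a}) →
          (∀ k < m, ISStepSH R rp (seq k) (seq (k + 1))) →
          m ≤ C * Fintype.card A ^ 5 := by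
  refine ⟨100, by norm_num, ?_⟩
  intro A _ _ R rp h1 h2 h3 m seq h0 hst
  exact main_bound (fun i => opr_SPref R rp i (h1 i) (h2 i) (h3 i)) m seq h0 hst
end

section
/- Consider a hedonic diversity game in which all agents have strict and naturally single-peaked preferences, and a sequence of IS deviations π_0, π_1, …, π_K starting from the singleton partition π_0 in which every deviation satisfies solitary homogeneity. Then for every k, every coalition in π_k is of one of the forms {r}, {b}, {r, b_1, …, b_m}, or {b, r_1, …, r_{m'}}, where r and the r_i are red agents and b and the b_j are blue agents (i.e., every coalition contains at most one red agent or at most one blue agent). Moreover, if {r, b_1, …, b_m} ∈ π_k with m ≥ 2 then the red agent r's preferences satisfy 1/(m+1) ≻_r 1/m ≻_r ⋯ ≻_r 1/2 ≻_r 1, and if {b, r_1, …, r_{m'}} ∈ π_k with m' ≥ 2 then the blue agent b's preferences satisfy m'/(m'+1) ≻_b (m'−1)/m' ≻_b ⋯ ≻_b 1/2 ≻_b 0. -/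
namespace HDGAux

/-- A game on ratios in `S`, with just the properties needed (closed under swapping colours). -/
structure Game {A : Type} [Fintype A] [DecidableEq A] (R : Finset A) (S : Set ℚ)
    (rp : A → ℚ → ℚ → Prop) : Prop where
  wo : ∀ i, WeakOrderOn (rp i) S
  st : ∀ i, StrictPrefsOn (rp i) S
  sp : ∀ i, SinglePeakedOn (rp i) S
  mem : ∀ a b : ℕ, a ≤ R.card → b ≤ Rᶜ.card → 1 ≤ a + b → (a : ℚ) / ((a : ℚ) + b) ∈ S

/-- The mirrored preferences. -/
def mir {A : Type} (rp : A → ℚ → ℚ → Prop) : A → ℚ → ℚ → Prop :=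
  fun i x y => rp i (1 - x) (1 - y)

lemma mir_mir {A : Type} (rp : A → ℚ → ℚ → Prop) : mir (mir rp) = rp := by
  funext i x y
  simp [mir]

/-- Half of the invariant. -/
def Half {A : Type} [Fintype A] [DecidableEq A] (R : Finset A)
    (rp : A → ℚ → ℚ → Prop) (C : Finset A) : Prop :=
  (R ∩ C).card = 1 → 2 ≤ (Rᶜ ∩ C).card → ∀ r ∈ R ∩ C, ∀ j : ℕ, 1 ≤ j → j ≤ (Rᶜ ∩ C).card →
    StrictPref (rp r) (1 / ((j : ℚ) + 1)) (1 / (j : ℚ))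

/-- The invariant. -/
def Inv {A : Type} [Fintype A] [DecidableEq A] (R : Finset A)
    (rp : A → ℚ → ℚ → Prop) (C : Finset A) : Prop :=
  ((R ∩ C).card ≤ 1 ∨ (Rᶜ ∩ C).card ≤ 1) ∧
  ((R ∩ C).card = 0 → (Rᶜ ∩ C).card ≤ 1) ∧
  ((Rᶜ ∩ C).card = 0 → (R ∩ C).card ≤ 1) ∧
  Half R rp C ∧ Half Rᶜ (mir rp) C

section
variable {A : Type} [Fintype A] [DecidableEq A] {R : Finset A} {S : Set ℚ}
  {rp : A → ℚ → ℚ → Prop}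

lemma Inv.swap {C : Finset A} (h : Inv R rp C) : Inv Rᶜ (mir rp) C := by
  obtain ⟨h1, h2, h3, h4, h5⟩ := h
  refine ⟨?_, ?_, ?_, h5, ?_⟩
  · rw [compl_compl]; exact h1.symm
  · rw [compl_compl]; exact h3
  · rw [compl_compl]; exact h2
  · rw [compl_compl, mir_mir]; exact h4

lemma Game.swap (g : Game R S rp) : Game Rᶜ {x | 1 - x ∈ S} (mir rp) where
  wo i := ⟨fun x hx y hy => (g.wo i).1 _ hx _ hy,
    fun x hx y hy z hz => (g.wo i).2 _ hx _ hy _ hz⟩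
  st i x hx y hy h1 h2 := by
    have := g.st i _ hx _ hy h1 h2
    linarith
  sp i x hx y hy z hz h hs := by
    refine g.sp i _ hx _ hy _ hz ?_ hs
    rcases h with h | h
    · right; constructor <;> linarith [h.1, h.2]
    · left; constructor <;> linarith [h.1, h.2]
  mem a b ha hb hab := by
    rw [compl_compl] at hb
    have := g.mem b a hb ha (by omega)
    have h : ((a : ℚ) + b) ≠ 0 := by
      have : (0 : ℚ) < ((a + b : ℕ) : ℚ) := by exact_mod_cast hab
      push_cast at this
      exact this.ne'
    have e : 1 - (a : ℚ) / (a + b) = b / (b + a) := by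
      rw [add_comm (b : ℚ) a]
      field_simp
      ring
    simp only [Set.mem_setOf_eq, e]
    exact this

lemma card_split (R C : Finset A) : C.card = (R ∩ C).card + (Rᶜ ∩ C).card := by
  rw [← Finset.card_union_of_disjoint]
  · congr 1
    ext x
    simp only [Finset.mem_union, Finset.mem_inter, Finset.mem_compl]
    tauto
  · rw [Finset.disjoint_left]
    intro x
    simp only [Finset.mem_inter, Finset.mem_compl]
    tauto

lemma ratio_eq (R C : Finset A) :
    redRatio R C = ((R ∩ C).card : ℚ) / (((R ∩ C).card : ℚ) + ((Rᶜ ∩ C).card : ℚ)) := by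
  rw [redRatio, card_split R C]
  push_cast
  rfl

lemma ratio_swap (R : Finset A) {C : Finset A} (h : C.Nonempty) :
    1 - redRatio Rᶜ C = redRatio R C := by
  have h0 : (0 : ℚ) < C.card := by exact_mod_cast h.card_pos
  have := card_split R C
  have h1 : (C.card : ℚ) = (R ∩ C).card + (Rᶜ ∩ C).card := by exact_mod_cast this
  unfold redRatio
  field_simp
  linarith

lemma Game.strict (g : Game R S rp) {i : A} {x y : ℚ} (hx : x ∈ S) (hy : y ∈ S)
    (h : rp i x y) (hne : x ≠ y) : StrictPref (rp i) x y :=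
  ⟨h, fun h' => hne (g.st i x hx y hy h h')⟩

lemma Game.mem_inv (g : Game R S rp) {m : ℕ} (hR : 1 ≤ R.card) (hm : m ≤ Rᶜ.card) :
    1 / ((m : ℚ) + 1) ∈ S := by
  have := g.mem 1 m hR hm (by omega)
  rw [add_comm]
  simpa using this

lemma Game.mem_ratio (g : Game R S rp) {C : Finset A} (h : C.Nonempty) : redRatio R C ∈ S := by
  rw [ratio_eq]
  apply g.mem
  · exact Finset.card_le_card Finset.inter_subset_left
  · exact Finset.card_le_card Finset.inter_subset_left
  · rw [← card_split]; exact h.card_pos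

lemma Game.chain (g : Game R S rp) {i : A} {m : ℕ} (hR : 1 ≤ R.card) (hm1 : 1 ≤ m)
    (hm : m ≤ Rᶜ.card)
    (h : StrictPref (rp i) (1 / ((m : ℚ) + 1)) (1 / (m : ℚ))) :
    ∀ j : ℕ, 1 ≤ j → j ≤ m → StrictPref (rp i) (1 / ((j : ℚ) + 1)) (1 / (j : ℚ)) := by
  induction m, hm1 using Nat.le_induction with
  | base =>
    intro j h1 h2
    obtain rfl : j = 1 := by omega
    exact h
  | succ m hm1 ih =>
    intro j h1 h2
    rcases Nat.lt_or_ge m j with hj | hj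
    · obtain rfl : j = m + 1 := by omega
      exact h
    · refine ih (by omega) ?_ j h1 hj
      have hpos : (0 : ℚ) < m := by exact_mod_cast hm1
      have m2 := g.mem_inv (m := m + 1) hR hm
      have m1 := g.mem_inv (m := m) hR (by omega)
      have m0 := g.mem_inv (m := m - 1) hR (by omega)
      have e : ((m - 1 : ℕ) : ℚ) + 1 = m := by
        have : m - 1 + 1 = m := by omega
        exact_mod_cast this
      rw [e] at m0
      have lt1 : 1 / (((m + 1 : ℕ) : ℚ) + 1) < 1 / ((m : ℚ) + 1) := by
        apply one_div_lt_one_div_of_lt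
        · linarith
        · push_cast; linarith
      have lt2 : 1 / ((m : ℚ) + 1) < 1 / (m : ℚ) := by
        apply one_div_lt_one_div_of_lt hpos
        linarith
      refine g.strict m1 m0 ?_ lt2.ne
      refine g.sp i _ m2 _ m1 _ m0 (Or.inl ⟨lt1, lt2⟩) ?_
      have : ((m + 1 : ℕ) : ℚ) = (m : ℚ) + 1 := by push_cast; rfl
      rw [← this] at *
      exact h

/-- If the red agent likes `1/(q+1)` better than `1/q`, then it is strictly better than any
ratio at least `1/q`. -/
lemma Game.top (g : Game R S rp) {i : A} {q : ℕ} (hR : 1 ≤ R.card) (hq : 1 ≤ q)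
    (hqR : q ≤ Rᶜ.card) (h : StrictPref (rp i) (1 / ((q : ℚ) + 1)) (1 / (q : ℚ)))
    {x : ℚ} (hx : x ∈ S) (hxq : 1 / (q : ℚ) ≤ x) : ¬ rp i x (1 / ((q : ℚ) + 1)) := by
  intro hr
  have hpos : (0 : ℚ) < q := by exact_mod_cast hq
  have m1 := g.mem_inv (m := q) hR hqR
  have m0 := g.mem_inv (m := q - 1) hR (by omega)
  have e : ((q - 1 : ℕ) : ℚ) + 1 = q := by
    have : q - 1 + 1 = q := by omega
    exact_mod_cast this
  rw [e] at m0
  have lt2 : 1 / ((q : ℚ) + 1) < 1 / (q : ℚ) := by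
    apply one_div_lt_one_div_of_lt hpos
    linarith
  have h0 : rp i (1 / (q : ℚ)) x := by
    rcases hxq.eq_or_lt with he | hl
    · rw [← he]
      rcases (g.wo i).1 _ m0 _ m0 with h | h <;> exact h
    · exact g.sp i _ m1 _ m0 _ hx (Or.inl ⟨lt2, hl⟩) h
  exact h.2 ((g.wo i).2 _ m0 _ hx _ m1 h0 hr)

lemma inv_singleton (R : Finset A) (rp : A → ℚ → ℚ → Prop) (a : A) : Inv R rp {a} := by
  have h := card_split R {a}
  rw [Finset.card_singleton] at h
  refine ⟨by omega, by omega, by omega, ?_, ?_⟩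
  · intro _ h2; omega
  · intro h1 h2; rw [compl_compl] at h2; omega

lemma red_insert {i : A} {D : Finset A} (hi : i ∈ R) (hD : i ∉ D) :
    (R ∩ insert i D).card = (R ∩ D).card + 1 := by
  rw [Finset.inter_insert_of_mem hi, Finset.card_insert_of_notMem]
  simp [hD]

lemma blue_insert {i : A} {D : Finset A} (hi : i ∈ R) :
    Rᶜ ∩ insert i D = Rᶜ ∩ D := by
  rw [Finset.inter_insert_of_notMem]
  simpa using hi

/-- Possible joins of a red agent. -/
lemma join_cases (g : Game R S rp) {i : A} {D : Finset A} (hi : i ∈ R) (hiD : i ∉ D)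
    (hne : D.Nonempty) (hinv : Inv R rp D)
    (hacc : ∀ j ∈ D, rp j (redRatio R (insert i D)) (redRatio R D))
    (hsh : HomogeneousCoalition R (insert i D) → (insert i D).card = 1) :
    (Rᶜ ∩ D).card = 1 := by
  obtain ⟨h1, h2, h3, h4, h5⟩ := hinv
  have hc := card_split R D
  have hp := hne.card_pos
  have hR : 1 ≤ R.card := Finset.card_pos.2 ⟨i, hi⟩
  by_contra hcon
  rcases Nat.lt_or_ge 1 (Rᶜ ∩ D).card with ht | ht
  · -- many blue agents
    have hs : (R ∩ D).card = 1 := by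
      rcases h1 with h | h
      · by_contra h'
        have := h2 (by omega)
        omega
      · omega
    obtain ⟨r, hr⟩ := Finset.card_pos.1 (by omega : 0 < (R ∩ D).card)
    have hch := h4 hs ht r hr _ (by omega) le_rfl
    have ha := hacc r (Finset.mem_inter.1 hr).2
    rw [ratio_eq R D, hs, Nat.cast_one, add_comm (1 : ℚ)] at ha
    refine g.top hR (by omega) (Finset.card_le_card Finset.inter_subset_left) hch
      (g.mem_ratio ⟨i, Finset.mem_insert_self _ _⟩) ?_ ha
    rw [ratio_eq, red_insert hi hiD, blue_insert hi, hs]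
    have h2t : (2 : ℚ) ≤ (Rᶜ ∩ D).card := by exact_mod_cast ht
    rw [div_le_div_iff₀ (by linarith) (by push_cast; linarith)]
    push_cast
    linarith
  · have h0 : (Rᶜ ∩ D).card = 0 := by omega
    have : HomogeneousCoalition R (insert i D) := by
      left
      intro x hx
      rcases Finset.mem_insert.1 hx with rfl | hx
      · exact hi
      · by_contra hxR
        have : x ∈ Rᶜ ∩ D := by simp [hx, hxR]
        rw [Finset.card_eq_zero] at h0
        simp [h0] at this
    have := hsh this
    rw [Finset.card_insert_of_notMem hiD] at this
    omega

lemma join_inv (g : Game R S rp) {i : A} {D : Finset A} (hi : i ∈ R) (hiD : i ∉ D)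
    (hacc : ∀ j ∈ D, rp j (redRatio R (insert i D)) (redRatio R D))
    (ht : (Rᶜ ∩ D).card = 1) : Inv R rp (insert i D) := by
  have e1 := red_insert hi hiD
  have e2 := blue_insert (D := D) hi
  refine ⟨?_, ?_, ?_, ?_, ?_⟩
  · right; rw [e2]; omega
  · intro h; omega
  · intro h; rw [e2] at h; omega
  · intro _ h; rw [e2] at h; omega
  · intro _ h b hb
    rw [compl_compl] at h ⊢
    rw [e2] at hb
    have hbD := (Finset.mem_inter.1 hb).2
    have hbR := (Finset.mem_inter.1 hb).1
    refine g.swap.chain (Finset.card_pos.2 ⟨b, hbR⟩) (by omega) ?_ ?_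
    · rw [compl_compl]; exact Finset.card_le_card Finset.inter_subset_left
    · have neD : D.Nonempty := ⟨b, hbD⟩
      have neI : (insert i D).Nonempty := ⟨i, Finset.mem_insert_self _ _⟩
      have ha : mir rp b (redRatio Rᶜ (insert i D)) (redRatio Rᶜ D) := by
        unfold mir
        rw [ratio_swap R neD, ratio_swap R neI]
        exact hacc b hbD
      have r1 : redRatio Rᶜ (insert i D) = 1 / (((R ∩ insert i D).card : ℚ) + 1) := by
        rw [ratio_eq, compl_compl, e2, ht, Nat.cast_one, add_comm]
      have r2 : redRatio Rᶜ D = 1 / ((R ∩ insert i D).card : ℚ) := by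
        rw [ratio_eq, compl_compl, ht, e1]
        push_cast
        rw [add_comm]
      have m1 := g.swap.mem_ratio neI
      have m2 := g.swap.mem_ratio neD
      rw [r1] at m1 ha
      rw [r2] at m2 ha
      refine g.swap.strict m1 m2 ha ?_
      apply ne_of_lt
      apply one_div_lt_one_div_of_lt
      · exact_mod_cast (by omega : 0 < (R ∩ insert i D).card)
      · linarith

lemma leave_inv (g : Game R S rp) {i : A} {C : Finset A} (hi : i ∈ R) (hiC : i ∈ C)
    (hinv : Inv R rp C) {x : ℚ} (hx : x ∈ S) (hx2 : 1 / 2 ≤ x) (hpref : rp i x (redRatio R C)) :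
    Inv R rp (C.erase i) := by
  obtain ⟨D, hD, rfl⟩ : ∃ D, i ∉ D ∧ C = insert i D :=
    ⟨C.erase i, Finset.notMem_erase _ _, (Finset.insert_erase hiC).symm⟩
  rw [Finset.erase_insert hD]
  have e1 := red_insert hi hD
  have e2 := blue_insert (D := D) hi
  obtain ⟨h1, h2, h3, h4, h5⟩ := hinv
  have hR : 1 ≤ R.card := Finset.card_pos.2 ⟨i, hi⟩
  rw [e1, e2] at h1 h3
  have key : (R ∩ D).card = 0 → (Rᶜ ∩ D).card ≤ 1 := by
    intro h0
    by_contra hcon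
    have hch := h4 (by omega) (by rw [e2]; omega) i (by simp [hi]) _
      (by rw [e2]; omega) le_rfl
    rw [ratio_eq, e1, h0, zero_add, Nat.cast_one, add_comm (1 : ℚ)] at hpref
    refine g.top hR (by rw [e2]; omega) (Finset.card_le_card Finset.inter_subset_left) hch
      hx ?_ hpref
    refine le_trans ?_ hx2
    apply one_div_le_one_div_of_le (by norm_num)
    rw [e2]
    exact_mod_cast (by omega : 2 ≤ (Rᶜ ∩ D).card)
  refine ⟨by omega, key, by omega, ?_, ?_⟩
  · intro a b; omega
  · intro a b r hr j hj1 hj2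
    rw [compl_compl] at b hj2
    refine h5 (by rw [e2]; exact a) (by rw [compl_compl]; omega) r (by rw [e2]; exact hr) j hj1 ?_
    rw [compl_compl]; omega

lemma step_red (g : Game R S rp) {π π' : A → Finset A} (hp : IsPartition π)
    (hp' : IsPartition π') {i : A} (hi : i ∈ R)
    (hdev : IsISDeviation (hdgPref R rp) π π' i)
    (hsh : HomogeneousCoalition R (π' i) → (π' i).card = 1)
    (hinv : ∀ a, Inv R rp (π a)) : ∀ a, Inv R rp (π' a) := by
  obtain ⟨d1, d2, d3, d4⟩ := hdev
  have hR : 1 ≤ R.card := Finset.card_pos.2 ⟨i, hi⟩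
  -- the new coalition of the deviator
  have hnew : Inv R rp (π' i) ∧ 1 / 2 ≤ redRatio R (π' i) := by
    by_cases hE : ((π' i).erase i).Nonempty
    · obtain ⟨j, hj⟩ := hE
      have hji := (Finset.mem_erase.1 hj).1
      have all : ∀ j ∈ (π' i).erase i, π' j = π' i ∧ π j = (π' i).erase i := by
        intro j hj
        have hji := (Finset.mem_erase.1 hj).1
        have e := hp'.2 j i (Finset.mem_erase.1 hj).2
        refine ⟨e, ?_⟩
        have e2 := d2 j hji
        rw [e] at e2
        by_cases hij : i ∈ π j
        · exfalso
          have e3 := hp.2 i j hij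
          apply d1
          rw [← e3] at e2
          rw [← Finset.insert_erase (hp'.1 i), e2, Finset.insert_erase (hp.1 i)]
        · rw [e2, Finset.erase_eq_of_notMem hij]
      have hins : insert i ((π' i).erase i) = π' i := Finset.insert_erase (hp'.1 i)
      set D := (π' i).erase i with hDdef
      have hiD : i ∉ D := Finset.notMem_erase _ _
      have hacc : ∀ j ∈ D, rp j (redRatio R (insert i D)) (redRatio R D) := by
        intro j hj
        have := d4 j hj
        rw [(all j hj).1, (all j hj).2] at this
        rw [hins]
        exact this
      have hDinv : Inv R rp D := by
        rw [← (all j hj).2]; exact hinv j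
      have ht := join_cases g hi hiD ⟨j, hj⟩ hDinv hacc (by rw [hins]; exact hsh)
      rw [← hins]
      refine ⟨join_inv g hi hiD hacc ht, ?_⟩
      rw [ratio_eq, red_insert hi hiD, blue_insert hi, ht]
      have : (0 : ℚ) ≤ (R ∩ D).card := by positivity
      push_cast
      rw [div_le_div_iff₀ (by norm_num) (by linarith)]
      linarith
    · rw [Finset.not_nonempty_iff_eq_empty] at hE
      have : π' i = {i} := by
        rw [← Finset.insert_erase (hp'.1 i), hE]; rfl
      rw [this]
      refine ⟨inv_singleton R rp i, ?_⟩
      have : R ∩ {i} = {i} := by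
        rw [Finset.inter_singleton_of_mem hi]
      rw [redRatio, this]
      norm_num
  intro a
  by_cases hia : i ∈ π' a
  · rw [← hp'.2 i a hia]; exact hnew.1
  · have hai : a ≠ i := by
      rintro rfl
      exact hia (hp'.1 a)
    have e := d2 a hai
    rw [Finset.erase_eq_of_notMem hia] at e
    rw [e]
    by_cases hia2 : i ∈ π a
    · have e3 := hp.2 i a hia2
      refine leave_inv g hi hia2 (hinv a) (g.mem_ratio ⟨i, hp'.1 i⟩) hnew.2 ?_
      rw [← e3]
      exact d3.1
    · rw [Finset.erase_eq_of_notMem hia2]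
      exact hinv a

lemma step (g : Game R S rp) {π π' : A → Finset A} (h : ISStepSH R rp π π')
    (hinv : ∀ a, Inv R rp (π a)) : ∀ a, Inv R rp (π' a) := by
  obtain ⟨hp, hp', i, hdev, hsh⟩ := h
  by_cases hi : i ∈ R
  · exact step_red g hp hp' hi hdev hsh hinv
  · have key := step_red g.swap hp hp' (i := i) (by simpa using hi) ?_ ?_
      (fun a => (hinv a).swap)
    · intro a
      have := (key a).swap
      rwa [compl_compl, mir_mir] at this
    · have e : ∀ j k l, hdgPref Rᶜ (mir rp) j (π' k) (π l) = hdgPref R rp j (π' k) (π l) := by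
        intro j k l
        unfold hdgPref mir
        rw [ratio_swap R ⟨k, hp'.1 k⟩, ratio_swap R ⟨l, hp.1 l⟩]
      have e' : ∀ j k l, hdgPref Rᶜ (mir rp) j (π k) (π' l) = hdgPref R rp j (π k) (π' l) := by
        intro j k l
        unfold hdgPref mir
        rw [ratio_swap R ⟨k, hp.1 k⟩, ratio_swap R ⟨l, hp'.1 l⟩]
      obtain ⟨d1, d2, d3, d4⟩ := hdev
      refine ⟨d1, d2, ?_, ?_⟩
      · unfold StrictPref
        rw [e, e']
        exact d3
      · intro j hj
        rw [e]
        exact d4 j hj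
    · intro hh
      apply hsh
      rcases hh with hh | hh
      · right
        intro a ha
        simpa using hh ha
      · left
        intro a ha
        simpa using hh a ha

end

end HDGAux

/-- Structure of the coalitions along any solitary-homogeneous IS dynamics
starting from the singleton partition in a hedonic diversity game with strict
and naturally single-peaked preferences: every coalition contains at most one
red agent or at most one blue agent, and the exceptional agent's preferences
satisfy the stated chains. -/
theorem hdg_dynamics_coalition_structure
    (A : Type) [Fintype A] [DecidableEq A]
    (R : Finset A) (rp : A → ℚ → ℚ → Prop)
    (hwo : ∀ i, WeakOrderOn (rp i) (RatioSet R.card (Fintype.card A)))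
    (hstrict : ∀ i, StrictPrefsOn (rp i) (RatioSet R.card (Fintype.card A)))
    (hsp : ∀ i, SinglePeakedOn (rp i) (RatioSet R.card (Fintype.card A)))
    (K : ℕ) (seq : ℕ → A → Finset A)
    (h0 : seq 0 = fun a => {a})
    (hstep : ∀ k < K, ISStepSH R rp (seq k) (seq (k + 1))) :
    ∀ k ≤ K, ∀ a : A,
      ((R ∩ seq k a).card ≤ 1 ∨ (seq k a \ R).card ≤ 1) ∧
      ((R ∩ seq k a).card = 1 → 2 ≤ (seq k a \ R).card →
        ∀ r ∈ R ∩ seq k a,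
          (∀ j : ℕ, 2 ≤ j → j ≤ (seq k a \ R).card →
            StrictPref (rp r) (1 / ((j : ℚ) + 1)) (1 / (j : ℚ))) ∧
          StrictPref (rp r) (1 / 2) 1) ∧
      ((seq k a \ R).card = 1 → 2 ≤ (R ∩ seq k a).card →
        ∀ b ∈ seq k a \ R,
          (∀ j : ℕ, 2 ≤ j → j ≤ (R ∩ seq k a).card →
            StrictPref (rp b) ((j : ℚ) / ((j : ℚ) + 1)) (((j : ℚ) - 1) / (j : ℚ))) ∧
          StrictPref (rp b) (1 / 2) 0) := by
  have g : HDGAux.Game R (RatioSet R.card (Fintype.card A)) rp := by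
    refine ⟨hwo, hstrict, hsp, ?_⟩
    intro a b ha hb hab
    refine ⟨a, a + b, ha, hab, ?_, by push_cast; rfl⟩
    have := Finset.card_add_card_compl R
    omega
  have main : ∀ k ≤ K, ∀ a, HDGAux.Inv R rp (seq k a) := by
    intro k
    induction k with
    | zero =>
      intro _ a
      rw [h0]
      exact HDGAux.inv_singleton R rp a
    | succ k ih =>
      intro hk
      exact HDGAux.step g (hstep k (by omega)) (ih (by omega))
  intro k hk a
  have hs : seq k a \ R = Rᶜ ∩ seq k a := by
    ext x
    simp only [Finset.mem_sdiff, Finset.mem_inter, Finset.mem_compl]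
    tauto
  rw [hs]
  obtain ⟨h1, -, -, h4, h5⟩ := main k hk a
  refine ⟨h1, ?_, ?_⟩
  · intro a1 a2 r hr
    have := h4 a1 a2 r hr
    refine ⟨fun j hj1 hj2 => this j (by omega) hj2, ?_⟩
    have := this 1 le_rfl (by omega)
    norm_num at this ⊢
    exact this
  · intro a1 a2 b hb
    have := h5 a1 (by rw [compl_compl]; exact a2) b hb
    rw [compl_compl] at this
    have conv : ∀ j : ℕ, 1 ≤ j → j ≤ (R ∩ seq k a).card →
        StrictPref (rp b) ((j : ℚ) / ((j : ℚ) + 1)) (((j : ℚ) - 1) / (j : ℚ)) := by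
      intro j hj1 hj2
      have h := this j hj1 hj2
      have hpos : (0 : ℚ) < j := by exact_mod_cast hj1
      have e1 : 1 - 1 / ((j : ℚ) + 1) = (j : ℚ) / ((j : ℚ) + 1) := by
        field_simp
        ring
      have e2 : 1 - 1 / (j : ℚ) = ((j : ℚ) - 1) / (j : ℚ) := by
        field_simp
      rw [← e1, ← e2]
      exact h
    refine ⟨fun j hj1 hj2 => conv j (by omega) hj2, ?_⟩
    have := conv 1 le_rfl (by omega)
    norm_num at this ⊢
    exact this
end
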